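/- Commutator estimate in Sobolev spaces on a bounded domain: Let Ω be a bounded smooth domain in ℝⁿ, n ≥ 2, let m be a positive integer, α a multi-index with |α| = m, and let 1 ≤ q, r₁, r₂, s₁, s₂ ≤ ∞ satisfy 1/q = 1/r₁ + 1/s₁ = 1/r₂ + 1/s₂. Then there is a positive constant C, depending only on m, q, r₁, r₂, s₁, s₂, n, and Ω, such that for all functions f and g for which the right-hand side is finite: ‖[D^α, f]g‖_{L^q(Ω)} ≤ C(‖∇f‖_{L^{r₁}(Ω)} ‖g‖_{W^{m−1,s₁}(Ω)} + ‖g‖_{L^{r₂}(Ω)} ‖f‖_{W^{m,s₂}(Ω)}), where [D^α, f]g := D^α(fg) − f D^α g. -/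

import Mathlib

open MeasureTheory Real Set ENNReal NNReal

noncomputable section

/-- Partial derivative in direction `i` for functions on `ℝⁿ`. -/
def pdN {n : ℕ} (i : Fin n) (f : (Fin n → ℝ) → ℝ) : (Fin n → ℝ) → ℝ :=
  fun x => fderiv ℝ f x (Pi.single i 1)

/-- Iterated directional derivative along a list of directions. -/
def Dlist {n : ℕ} (l : List (Fin n)) (f : (Fin n → ℝ) → ℝ) : (Fin n → ℝ) → ℝ :=
  l.foldr pdN f

/-- The derivative `D^α` associated with a multi-index `α`. -/
def Dm {n : ℕ} (α : Fin n → ℕ) (f : (Fin n → ℝ) → ℝ) : (Fin n → ℝ) → ℝ :=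
  Dlist ((List.finRange n).flatMap fun i => List.replicate (α i) i) f

/-- The order `|α|` of a multi-index. -/
def mOrder {n : ℕ} (α : Fin n → ℕ) : ℕ := ∑ i, α i

/-- The `L^q(Ω)` norm (valued in `ℝ≥0∞`; `q = ∞` is allowed). -/
def LqN {n : ℕ} (q : ℝ≥0∞) (Ω : Set (Fin n → ℝ)) (f : (Fin n → ℝ) → ℝ) : ℝ≥0∞ :=
  eLpNorm f q (volume.restrict Ω)

/-- The `W^{m,q}(Ω)` norm. -/
def WNorm {n : ℕ} (m : ℕ) (q : ℝ≥0∞) (Ω : Set (Fin n → ℝ))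
    (f : (Fin n → ℝ) → ℝ) : ℝ≥0∞ :=
  ∑ i ∈ Finset.range (m + 1),
    eLpNorm (fun x => ‖iteratedFDeriv ℝ i f x‖) q (volume.restrict Ω)

/-- A bounded smooth domain in `ℝⁿ`: an open bounded set which is the sublevel
set of a smooth function with nonvanishing gradient on the boundary. -/
def SmoothDomain {n : ℕ} (Ω : Set (Fin n → ℝ)) : Prop :=
  IsOpen Ω ∧ Bornology.IsBounded Ω ∧
    ∃ F : (Fin n → ℝ) → ℝ, ContDiff ℝ (⊤ : ℕ∞) F ∧ Ω = {x | F x < 0} ∧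
      ∀ x ∈ frontier Ω, fderiv ℝ F x ≠ 0

lemma exists_norm_le_integral {E : Type*} [NormedAddCommGroup E] {w : ℝ → E}
    (hw : Continuous w) {a b : ℝ} (hab : a ≤ b) :
    ∃ c ∈ Icc a b, (b - a) * ‖w c‖ ≤ ∫ t in a..b, ‖w t‖ := by
  obtain ⟨c, hc, hmin⟩ := isCompact_Icc.exists_isMinOn (nonempty_Icc.2 hab) hw.norm.continuousOn
  refine ⟨c, hc, ?_⟩
  have h := intervalIntegral.integral_mono_on (μ := volume) hab
    (intervalIntegrable_const (c := ‖w c‖)) (hw.norm.intervalIntegrable a b) (fun t ht => hmin ht)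
  simpa using h

/-- A derivative on an interval is controlled by the mean of the function and the total
variation of the derivative. -/
lemma norm_deriv_le_of_interval {E : Type*} [NormedAddCommGroup E] [NormedSpace ℝ E]
    [CompleteSpace E] {w w' w'' : ℝ → E} (hw : ∀ t, HasDerivAt w (w' t) t)
    (hw' : ∀ t, HasDerivAt w' (w'' t) t) (hw'' : Continuous w'') {l t : ℝ} (hl : 0 < l)
    (ht : t ∈ Icc 0 l) :
    l ^ 2 * ‖w' t‖ ≤ 9 * (∫ z in (0)..l, ‖w z‖) + l ^ 2 * ∫ z in (0)..l, ‖w'' z‖ := by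
  have hwc : Continuous w := continuous_iff_continuousAt.2 fun t => (hw t).continuousAt
  set b := ∫ z in (0)..l, ‖w'' z‖ with hb
  have hI : ∀ x y, IntervalIntegrable (fun z => ‖w'' z‖) volume x y :=
    fun x y => hw''.norm.intervalIntegrable x y
  have hosc : ∀ z ∈ Icc (0 : ℝ) l, ‖w' z - w' t‖ ≤ b := by
    intro z hz
    rw [← intervalIntegral.integral_eq_sub_of_hasDerivAt (fun x _ => hw' x)
      (hw''.intervalIntegrable t z)]
    refine (intervalIntegral.norm_integral_le_abs_integral_norm).trans ?_
    rw [hb, ← abs_of_nonneg (intervalIntegral.integral_nonneg hl.le fun x _ => norm_nonneg (w'' x))]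
    refine intervalIntegral.abs_integral_mono_interval ?_ ?_ (hI 0 l)
    · rw [uIoc_of_le hl.le]
      intro x hx
      rcases le_total t z with h | h
      · rw [uIoc_of_le h] at hx; exact ⟨ht.1.trans_lt hx.1, hx.2.trans hz.2⟩
      · rw [uIoc_of_ge h] at hx; exact ⟨hz.1.trans_lt hx.1, hx.2.trans ht.2⟩
    · exact Filter.Eventually.of_forall fun x => norm_nonneg _
  obtain ⟨c, hc, hc'⟩ := exists_norm_le_integral hwc (show (0 : ℝ) ≤ l / 3 by positivity)
  obtain ⟨d, hd, hd'⟩ := exists_norm_le_integral hwc (show 2 * l / 3 ≤ l by linarith)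
  have hcd : c ≤ d := by linarith [hc.2, hd.1]
  have hmv : ‖(w d - d • w' t) - (w c - c • w' t)‖ ≤ b * (d - c) := by
    refine norm_image_sub_le_of_norm_deriv_le_segment' (f := fun z => w z - z • w' t)
      (f' := fun z => w' z - w' t) ?_ ?_ d ⟨hcd, le_rfl⟩
    · intro x _
      have h := (hw x).sub ((hasDerivAt_id x).smul_const (w' t))
      rw [one_smul] at h
      exact h.hasDerivWithinAt
    · intro x hx
      exact hosc x ⟨hc.1.trans hx.1, hx.2.le.trans hd.2⟩
  have h1 : (d - c) * ‖w' t‖ ≤ ‖w c‖ + ‖w d‖ + b * (d - c) := by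
    have : (d - c) • w' t = w d - w c - ((w d - d • w' t) - (w c - c • w' t)) := by
      rw [sub_smul]; abel
    calc (d - c) * ‖w' t‖ = ‖(d - c) • w' t‖ := by
          rw [norm_smul, Real.norm_of_nonneg (by linarith)]
      _ ≤ ‖w d‖ + ‖w c‖ + b * (d - c) := by
          rw [this]
          refine (norm_sub_le _ _).trans (add_le_add (norm_sub_le _ _) hmv)
      _ = _ := by ring
  have hsum : (∫ z in (0)..l / 3, ‖w z‖) + (∫ z in (2 * l / 3)..l, ‖w z‖)
      ≤ ∫ z in (0)..l, ‖w z‖ := by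
    have hJ : ∀ x y, IntervalIntegrable (fun z => ‖w z‖) volume x y :=
      fun x y => hwc.norm.intervalIntegrable x y
    have h0 : 0 ≤ ∫ z in (l / 3)..(2 * l / 3), ‖w z‖ :=
      intervalIntegral.integral_nonneg (by linarith) fun x _ => norm_nonneg _
    rw [← intervalIntegral.integral_add_adjacent_intervals (hJ 0 (2 * l / 3)) (hJ _ l),
      ← intervalIntegral.integral_add_adjacent_intervals (hJ 0 (l / 3)) (hJ _ (2 * l / 3))]
    linarith
  have hdc : l / 3 ≤ d - c := by linarith [hc.2, hd.1]
  have h2 : (l / 3) * (‖w' t‖ - b) ≤ ‖w c‖ + ‖w d‖ := by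
    rcases le_total (‖w' t‖) b with h | h
    · have := mul_nonneg (show (0 : ℝ) ≤ l / 3 by positivity) (sub_nonneg.2 h)
      nlinarith [norm_nonneg (w c), norm_nonneg (w d)]
    · nlinarith [mul_le_mul_of_nonneg_right hdc (sub_nonneg.2 h)]
  nlinarith [mul_le_mul_of_nonneg_left h2 (show (0 : ℝ) ≤ 3 * l by positivity)]

/-- Selection of a length at which the mean of the function and that of its second derivative
are balanced. -/
lemma exists_balanced_length {E : Type*} [NormedAddCommGroup E] [NormedSpace ℝ E]
    [CompleteSpace E] {w w' w'' : ℝ → E} (hw : ∀ t, HasDerivAt w (w' t) t)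
    (hw' : ∀ t, HasDerivAt w' (w'' t) t) (hw'' : Continuous w'') {G : ℝ → ℝ} (hG : Continuous G)
    (hGw : ∀ t, ‖w t‖ + ‖w'' t‖ ≤ G t) {ε h M : ℝ} (hε : 0 < ε) (hεh : ε ≤ h) (hh : h ≤ 1)
    (hM : ∀ t ∈ Ioo 0 h, ‖w'' t‖ ≤ M) :
    ∃ l, ε ≤ l ∧ l ≤ h ∧ ((∀ t ∈ Icc 0 l, ‖w' t‖ ≤ 10 * (ε * M)) ∨
      ∀ t ∈ Icc 0 l, ‖w' t‖ ^ 2 ≤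
        (10 / h) ^ 2 * ((l⁻¹ * ∫ z in (0)..l, ‖w z‖) * (l⁻¹ * ∫ z in (0)..l, G z))) := by
  have hwc : Continuous w := continuous_iff_continuousAt.2 fun t => (hw t).continuousAt
  have key := fun {l t : ℝ} (hl : 0 < l) (ht : t ∈ Icc 0 l) =>
    norm_deriv_le_of_interval hw hw' hw'' hl ht
  set A : ℝ → ℝ := fun l => ∫ z in (0)..l, ‖w z‖ with hA
  set B : ℝ → ℝ := fun l => ∫ z in (0)..l, ‖w'' z‖ with hB
  have hAc : Continuous A :=
    intervalIntegral.continuous_primitive (fun a b => hwc.norm.intervalIntegrable a b) 0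
  have hBc : Continuous B :=
    intervalIntegral.continuous_primitive (fun a b => hw''.norm.intervalIntegrable a b) 0
  have hA0 : ∀ l, 0 ≤ l → 0 ≤ A l := fun l hl =>
    intervalIntegral.integral_nonneg hl fun x _ => norm_nonneg _
  have hABG : ∀ l, 0 ≤ l → A l + B l ≤ ∫ z in (0)..l, G z := by
    intro l hl
    simp only [hA, hB]
    rw [← intervalIntegral.integral_add (hwc.norm.intervalIntegrable _ _)
      (hw''.norm.intervalIntegrable _ _)]
    exact intervalIntegral.integral_mono_on hl
      ((hwc.norm.add hw''.norm).intervalIntegrable _ _) (hG.intervalIntegrable _ _)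
      fun x _ => hGw x
  have hB0 : ∀ l, 0 ≤ l → 0 ≤ B l := fun l hl =>
    intervalIntegral.integral_nonneg hl fun x _ => norm_nonneg _
  have hh0 : 0 < h := hε.trans_le hεh
  rcases le_total (A ε) (ε ^ 2 * B ε) with h1 | h1
  · refine ⟨ε, le_rfl, hεh, Or.inl fun t ht => ?_⟩
    have hBM : B ε ≤ ε * M := by
      have := intervalIntegral.integral_mono_on_of_le_Ioo (μ := volume) hε.le
        (hw''.norm.intervalIntegrable 0 ε)
        (intervalIntegrable_const (c := M)) (fun t ht => hM t ⟨ht.1, ht.2.trans_le hεh⟩)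
      simpa using this
    have h2 := key hε ht
    have h3 : ε ^ 2 * ‖w' t‖ ≤ ε ^ 2 * (10 * B ε) := by nlinarith
    linarith [le_of_mul_le_mul_left h3 (by positivity)]
  rcases le_total (h ^ 2 * B h) (A h) with h2 | h2
  · refine ⟨h, hεh, le_rfl, Or.inr fun t ht => ?_⟩
    have h3 := key hh0 ht
    have h4 : ‖w' t‖ ≤ (10 / h) * (h⁻¹ * A h) := by
      rw [show (10 / h) * (h⁻¹ * A h) = (10 * A h) / h ^ 2 by field_simp,
        le_div_iff₀ (by positivity)]
      nlinarith
    have h5 : h⁻¹ * A h ≤ h⁻¹ * ∫ z in (0)..h, G z :=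
      mul_le_mul_of_nonneg_left (by linarith [hABG h hh0.le, hB0 h hh0.le]) (by positivity)
    have h6 : 0 ≤ h⁻¹ * A h := mul_nonneg (by positivity) (hA0 h hh0.le)
    calc ‖w' t‖ ^ 2 ≤ ((10 / h) * (h⁻¹ * A h)) ^ 2 := by gcongr
      _ = (10 / h) ^ 2 * ((h⁻¹ * A h) * (h⁻¹ * A h)) := by ring
      _ ≤ _ := by gcongr
  · obtain ⟨l, hl, hl'⟩ : (0 : ℝ) ∈ (fun l => l ^ 2 * B l - A l) '' Icc ε h :=
      intermediate_value_Icc hεh (by fun_prop) ⟨by simpa using h1, by simpa using h2⟩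
    have hl0 : 0 < l := hε.trans_le hl.1
    have hbal : A l = l ^ 2 * B l := by simp only at hl'; linarith
    refine ⟨l, hl.1, hl.2, Or.inr fun t ht => ?_⟩
    have h3 := key hl0 ht
    have h4 : ‖w' t‖ ≤ 10 * B l := by
      have : l ^ 2 * ‖w' t‖ ≤ l ^ 2 * (10 * B l) := by
        simp only [hA, hB] at hbal ⊢; nlinarith
      exact le_of_mul_le_mul_left this (by positivity)
    have h5 : B l ≤ ∫ z in (0)..l, G z := by linarith [hABG l hl0.le, hA0 l hl0.le]
    have h7 : (10 : ℝ) ≤ 10 / h := by rw [le_div_iff₀ hh0]; linarith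
    have h8 := hB0 l hl0.le
    calc ‖w' t‖ ^ 2 ≤ (10 * B l) ^ 2 := by gcongr
      _ = 10 ^ 2 * ((l⁻¹ * A l) * (l⁻¹ * B l)) := by rw [hbal]; field_simp
      _ ≤ _ := by
        have := hA0 l hl0.le
        gcongr

/-- The integrand of the `L^r` modular; it vanishes for `r = ∞`. -/
def modularIntegrand (r : ℝ≥0∞) (x : ℝ) : ℝ := if r = ∞ then 0 else x ^ r.toReal

lemma modularIntegrand_nonneg (r : ℝ≥0∞) {x : ℝ} (hx : 0 ≤ x) : 0 ≤ modularIntegrand r x := by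
  unfold modularIntegrand; split_ifs <;> positivity

lemma continuous_modularIntegrand (r : ℝ≥0∞) : Continuous (modularIntegrand r) := by
  unfold modularIntegrand
  split_ifs with h
  · exact continuous_const
  · exact Real.continuous_rpow_const ENNReal.toReal_nonneg

/-- Jensen's inequality for the modular. -/
lemma modularIntegrand_mean_le {r : ℝ≥0∞} (hr : 1 ≤ r) {a : ℝ → ℝ} (ha : Continuous a)
    (ha0 : ∀ t, 0 ≤ a t) {l : ℝ} (hl : 0 < l) :
    modularIntegrand r (l⁻¹ * ∫ t in (0)..l, a t) ≤
      l⁻¹ * ∫ t in (0)..l, modularIntegrand r (a t) := by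
  by_cases h : r = ∞
  · simp [modularIntegrand, h]
  have h1 : 1 ≤ r.toReal := by
    simpa using ENNReal.toReal_mono h hr
  have := (convexOn_rpow h1).map_set_average_le (μ := volume) (t := Ioc 0 l) (f := a)
    (Real.continuous_rpow_const (by positivity)).continuousOn isClosed_Ici
    (by simp [hl]) (by simp) (Filter.Eventually.of_forall ha0)
    (ha.integrableOn_Ioc) ((ha.rpow_const fun _ => Or.inr (by positivity)).integrableOn_Ioc)
  simp only [modularIntegrand, h, if_false]
  rw [intervalIntegral.integral_of_le hl.le, intervalIntegral.integral_of_le hl.le]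
  simpa [setAverage_eq, measureReal_def, hl.le] using this

/-- Young's inequality for the modulars of exponents in harmonic mean `p`. -/
lemma rpow_mul_rpow_le_modularIntegrand {r s p : ℝ≥0∞} (hr : 1 ≤ r) (hs : 1 ≤ s) (hp : p ≠ ∞)
    (hrs : r⁻¹ + s⁻¹ = 2 * p⁻¹) {x y : ℝ} (hx : 0 ≤ x) (hy : 0 ≤ y)
    (hx1 : r = ∞ → x ≤ 1) (hy1 : s = ∞ → y ≤ 1) :
    (x * y) ^ (p.toReal / 2) ≤ modularIntegrand r x + modularIntegrand s y := by
  have hrs' : r.toReal⁻¹ + s.toReal⁻¹ = 2 * p.toReal⁻¹ := by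
    have hr0 : r⁻¹ ≠ ∞ := by simpa using (zero_lt_one.trans_le hr).ne'
    have hs0 : s⁻¹ ≠ ∞ := by simpa using (zero_lt_one.trans_le hs).ne'
    have := congrArg ENNReal.toReal hrs
    rwa [ENNReal.toReal_add hr0 hs0, ENNReal.toReal_mul, ENNReal.toReal_inv, ENNReal.toReal_inv,
      ENNReal.toReal_inv, ENNReal.toReal_ofNat] at this
  rw [Real.mul_rpow hx hy]
  have hpp : 0 < p.toReal := by
    refine ENNReal.toReal_pos ?_ hp
    rintro rfl
    have hr0 : r⁻¹ ≠ ∞ := by simpa using (zero_lt_one.trans_le hr).ne'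
    have hs0 : s⁻¹ ≠ ∞ := by simpa using (zero_lt_one.trans_le hs).ne'
    have h2 := ENNReal.add_ne_top.2 ⟨hr0, hs0⟩
    rw [hrs] at h2
    simp at h2
  have pos : ∀ {r : ℝ≥0∞}, 1 ≤ r → r ≠ ∞ → 0 < r.toReal := fun h1 h2 =>
    ENNReal.toReal_pos (zero_lt_one.trans_le h1).ne' h2
  by_cases h1 : r = ∞ <;> by_cases h2 : s = ∞
  · simp only [h1, h2, ENNReal.toReal_top, _root_.inv_zero, add_zero] at hrs'
    have : 0 < p.toReal⁻¹ := by positivity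
    linarith
  · have hps : p.toReal / 2 = s.toReal := by
      have := pos hs h2
      simp only [h1, ENNReal.toReal_top, _root_.inv_zero, zero_add] at hrs'
      field_simp at hrs' ⊢
      linarith
    simp only [modularIntegrand, h1, h2, if_true, if_false, zero_add, hps]
    exact mul_le_of_le_one_left (by positivity) (Real.rpow_le_one hx (hx1 h1) (by positivity))
  · have hps : p.toReal / 2 = r.toReal := by
      have := pos hr h1
      simp only [h2, ENNReal.toReal_top, _root_.inv_zero, add_zero] at hrs'
      field_simp at hrs' ⊢
      linarith
    simp only [modularIntegrand, h1, h2, if_true, if_false, add_zero, hps]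
    exact mul_le_of_le_one_right (by positivity) (Real.rpow_le_one hy (hy1 h2) (by positivity))
  · have hr' := pos hr h1
    have hs' := pos hs h2
    simp only [modularIntegrand, h1, h2, if_false]
    have hw : p.toReal / 2 / r.toReal + p.toReal / 2 / s.toReal = 1 := by
      have : p.toReal / 2 / r.toReal + p.toReal / 2 / s.toReal
        = p.toReal / 2 * (r.toReal⁻¹ + s.toReal⁻¹) := by ring
      rw [this, hrs']; field_simp
    have hw1 : 0 ≤ p.toReal / 2 / r.toReal := by positivity
    have hw2 : 0 ≤ p.toReal / 2 / s.toReal := by positivity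
    have hX : 0 ≤ x ^ r.toReal := by positivity
    have hY : 0 ≤ y ^ s.toReal := by positivity
    have := Real.geom_mean_le_arith_mean2_weighted hw1 hw2 hX hY hw
    rw [← Real.rpow_mul hx, ← Real.rpow_mul hy, mul_div_cancel₀ _ hr'.ne',
      mul_div_cancel₀ _ hs'.ne'] at this
    refine this.trans ?_
    nlinarith

/-- Greedy covering by intervals on which an integral inequality holds. -/
lemma lintegral_le_of_forall_exists_interval {u ψ : ℝ → ℝ≥0∞} {T : Set ℝ} {ε h : ℝ}
    (hε : 0 < ε)
    (hcov : ∀ τ, Ioo τ (τ + h) ⊆ T → ∃ l, ε ≤ l ∧ l ≤ h ∧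
      ∫⁻ t in Ioo τ (τ + l), u t ≤ ∫⁻ t in Ioo τ (τ + l), ψ t) (N : ℕ) :
    ∀ (c : ℝ) (S : Set ℝ), (∀ x ∈ S, Ioo x (x + h) ⊆ T) → S ⊆ Icc c (c + N * ε) →
      ∫⁻ t in S, u t ≤ ∫⁻ t in T ∩ Ioi c, ψ t := by
  induction N with
  | zero =>
    intro c S _ hS
    have : volume S = 0 := measure_mono_null hS (by simp)
    rw [setLIntegral_measure_zero _ _ this]
    exact zero_le
  | succ N ih =>
    intro c S hST hS
    rcases S.eq_empty_or_nonempty with rfl | hne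
    · simp
    have hbdd : BddBelow S := ⟨c, fun x hx => (hS hx).1⟩
    set τ := sInf S with hτ
    have hcτ : c ≤ τ := le_csInf hne fun x hx => (hS hx).1
    have hτT : Ioo τ (τ + h) ⊆ T := by
      intro y hy
      obtain ⟨x, hx, hxy⟩ := exists_lt_of_csInf_lt hne hy.1
      exact hST x hx ⟨hxy, hy.2.trans_le (by linarith [csInf_le hbdd hx])⟩
    obtain ⟨l, hl, hlh, hle⟩ := hcov τ hτT
    have hsub : S ⊆ Icc τ (τ + l) ∪ (S ∩ Ioi (τ + l)) := by
      intro x hx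
      rcases le_or_gt x (τ + l) with h | h
      · exact Or.inl ⟨csInf_le hbdd hx, h⟩
      · exact Or.inr ⟨hx, h⟩
    have hrec := ih (τ + l) (S ∩ Ioi (τ + l)) (fun x hx => hST x hx.1) (fun x hx =>
      ⟨hx.2.le, by have := (hS hx.1).2; push_cast at this; linarith⟩)
    calc ∫⁻ t in S, u t ≤ ∫⁻ t in Icc τ (τ + l) ∪ (S ∩ Ioi (τ + l)), u t :=
          lintegral_mono_set hsub
      _ ≤ (∫⁻ t in Icc τ (τ + l), u t) + ∫⁻ t in S ∩ Ioi (τ + l), u t := lintegral_union_le _ _ _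
      _ = (∫⁻ t in Ioo τ (τ + l), u t) + ∫⁻ t in S ∩ Ioi (τ + l), u t := by
          rw [setLIntegral_congr Ioo_ae_eq_Icc]
      _ ≤ (∫⁻ t in T ∩ Ioi (τ + l), ψ t) + ∫⁻ t in Ioo τ (τ + l), ψ t := by
          rw [add_comm]; exact add_le_add hrec hle
      _ = ∫⁻ t in (T ∩ Ioi (τ + l)) ∪ Ioo τ (τ + l), ψ t := by
          rw [lintegral_union measurableSet_Ioo]
          rw [Set.disjoint_left]
          intro x hx hx'
          exact absurd hx.2 (not_lt.2 hx'.2.le)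
      _ ≤ _ := by
          refine lintegral_mono_set ?_
          rintro x (hx | hx)
          · exact ⟨hx.1, (show c ≤ τ + l by linarith).trans_lt hx.2⟩
          · exact ⟨hτT ⟨hx.1, hx.2.trans_le (by linarith)⟩, hcτ.trans_lt hx.1⟩

/-- Integration along parallel lines of an inequality valid on long enough segments. -/
lemma lintegral_le_two_mul_of_segments {n : ℕ} {U Ψ : (Fin n → ℝ) → ℝ≥0∞} (hU : Measurable U)
    (hΨ : Measurable Ψ) {S Ω : Set (Fin n → ℝ)} (hS : MeasurableSet S) (hΩ : MeasurableSet Ω)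
    {e : Fin n → ℝ} {ε h : ℝ} (hε : 0 < ε) (hh : 0 < h)
    (hSΩ : ∀ x ∈ S, ∀ t ∈ Ioo 0 h, x + t • e ∈ Ω)
    (hcov : ∀ y, (∀ t ∈ Ioo 0 h, y + t • e ∈ Ω) → ∃ l, ε ≤ l ∧ l ≤ h ∧
      ∫⁻ t in Ioo 0 l, U (y + t • e) ≤ ∫⁻ t in Ioo 0 l, Ψ (y + t • e)) :
    ∫⁻ x in S, U x ≤ 2 * ∫⁻ x in Ω, Ψ x := by
  have shift : ∀ {W : (Fin n → ℝ) → ℝ≥0∞} (_ : Measurable W) (L : ℝ),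
      ∫⁻ x, ∫⁻ t in Ioo 0 L, W (x + t • e) = ENNReal.ofReal L * ∫⁻ x, W x := by
    intro W hW L
    rw [lintegral_lintegral_swap]
    · simp_rw [lintegral_add_right_eq_self W]
      simp [mul_comm]
    · refine (hW.comp ?_).aemeasurable
      fun_prop
  have line : ∀ x, ∫⁻ t in Ioo 0 h, S.indicator U (x + t • e) ≤
      ∫⁻ t in Ioo 0 (2 * h), Ω.indicator Ψ (x + t • e) := by
    intro x
    have hm : Measurable fun t : ℝ => x + t • e := by fun_prop
    obtain ⟨N, hN⟩ := exists_nat_ge (h / ε)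
    have hN' : h ≤ N * ε := by rwa [div_le_iff₀ hε] at hN
    have := lintegral_le_of_forall_exists_interval (u := fun t => U (x + t • e))
      (ψ := fun t => Ψ (x + t • e)) (T := {t | x + t • e ∈ Ω} ∩ Ioo 0 (2 * h)) (h := h) hε ?_ N 0
      ({t | x + t • e ∈ S} ∩ Ioo 0 h) ?_ ?_
    · calc ∫⁻ t in Ioo 0 h, S.indicator U (x + t • e)
          = ∫⁻ t in {t | x + t • e ∈ S} ∩ Ioo 0 h, U (x + t • e) := 
            setLIntegral_indicator (hm hS) fun t => U (x + t • e)
        _ ≤ _ := this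
        _ ≤ ∫⁻ t in {t | x + t • e ∈ Ω} ∩ Ioo 0 (2 * h), Ψ (x + t • e) :=
            lintegral_mono_set inter_subset_left
        _ = _ := (setLIntegral_indicator (hm hΩ) fun t => Ψ (x + t • e)).symm
    · intro τ hτ
      obtain ⟨l, h1, h2, h3⟩ := hcov (x + τ • e) (fun t ht => by
        have := (hτ (show τ + t ∈ Ioo τ (τ + h) from ⟨by linarith [ht.1], by linarith [ht.2]⟩)).1
        simpa [add_smul, add_assoc] using this)
      refine ⟨l, h1, h2, ?_⟩
      have tr : ∀ W : (Fin n → ℝ) → ℝ≥0∞, ∫⁻ t in Ioo τ (τ + l), W (x + t • e) =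
          ∫⁻ t in Ioo 0 l, W (x + τ • e + t • e) := by
        intro W
        have h4 := (measurePreserving_add_left (volume : Measure ℝ) τ).setLIntegral_comp_preimage_emb
          (measurableEmbedding_addLeft τ) (fun t => W (x + t • e)) (Ioo τ (τ + l))
        rw [← h4]
        simp [add_smul, add_assoc]
      rwa [tr, tr]
    · intro t ht s hs
      have h1 := ht.2.1
      have h2 := ht.2.2
      refine ⟨?_, by linarith [hs.1], by linarith [hs.2]⟩
      have := hSΩ _ ht.1 (s - t) ⟨by linarith [hs.1], by linarith [hs.2]⟩
      rw [add_assoc, ← add_smul, add_sub_cancel] at this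
      exact this
    · intro t ht
      exact ⟨ht.2.1.le, by linarith [ht.2.2]⟩
  have main := lintegral_mono (μ := (volume : Measure (Fin n → ℝ))) line
  rw [shift (hU.indicator hS), shift (hΨ.indicator hΩ), lintegral_indicator hS,
    lintegral_indicator hΩ, ENNReal.ofReal_mul zero_le_two, mul_comm (ENNReal.ofReal 2),
    mul_assoc, ENNReal.mul_le_mul_iff_right (by simpa using hh) ENNReal.ofReal_ne_top] at main
  simpa using main

lemma lintegral_modularIntegrand_le_one {X : Type*} [MeasurableSpace X] {μ : Measure X}
    {r : ℝ≥0∞} (hr : 1 ≤ r) {f : X → ℝ} (hf : ∀ x, 0 ≤ f x) {B : ℝ} (hB : 0 < B)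
    (h : eLpNorm f r μ ≤ ENNReal.ofReal B) :
    ∫⁻ x, ENNReal.ofReal (modularIntegrand r (f x / B)) ∂μ ≤ 1 := by
  by_cases hr' : r = ∞
  · simp [modularIntegrand, hr']
  have h0 : 0 < r.toReal := ENNReal.toReal_pos (zero_lt_one.trans_le hr).ne' hr'
  rw [eLpNorm_eq_lintegral_rpow_enorm_toReal (zero_lt_one.trans_le hr).ne' hr',
    one_div, ENNReal.rpow_inv_le_iff h0] at h
  have hpt : ∀ x, ENNReal.ofReal (modularIntegrand r (f x / B)) =
      (ENNReal.ofReal B ^ r.toReal)⁻¹ * ‖f x‖ₑ ^ r.toReal := by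
    intro x
    simp only [modularIntegrand, hr', if_false]
    rw [Real.enorm_of_nonneg (hf x), ← ENNReal.ofReal_rpow_of_nonneg (by have := hf x; positivity)
      h0.le, ENNReal.ofReal_div_of_pos hB, ENNReal.div_rpow_of_nonneg _ _ h0.le, ENNReal.div_eq_inv_mul]
  simp_rw [hpt]
  have hne : ENNReal.ofReal B ^ r.toReal ≠ 0 := by
    simp [hB, h0]
  have hne' : ENNReal.ofReal B ^ r.toReal ≠ ∞ := by simp [h0.le]
  rw [lintegral_const_mul' _ _ (by simpa using hne)]
  calc _ ≤ (ENNReal.ofReal B ^ r.toReal)⁻¹ * ENNReal.ofReal B ^ r.toReal := by gcongr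
    _ = 1 := ENNReal.inv_mul_cancel hne hne'

lemma le_of_eLpNorm_top_le {n : ℕ} {Ω : Set (Fin n → ℝ)} (hΩ : IsOpen Ω) {f : (Fin n → ℝ) → ℝ}
    (hf : Continuous f) (hf0 : ∀ x, 0 ≤ f x) {B : ℝ} (hB : 0 < B)
    (h : eLpNorm f ∞ (volume.restrict Ω) ≤ ENNReal.ofReal B) {x : Fin n → ℝ} (hx : x ∈ Ω) :
    f x ≤ B := by
  rw [eLpNorm_exponent_top] at h
  have hae : ∀ᵐ y ∂(volume.restrict Ω), f y ≤ B := by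
    filter_upwards [ae_le_eLpNormEssSup (f := f) (μ := volume.restrict Ω)] with y hy
    have := hy.trans h
    rwa [Real.enorm_of_nonneg (hf0 y), ENNReal.ofReal_le_ofReal_iff hB.le] at this
  rw [ae_restrict_iff' hΩ.measurableSet, ae_iff] at hae
  have hopen : IsOpen {y | ¬ (y ∈ Ω → f y ≤ B)} := by
    have : {y | ¬ (y ∈ Ω → f y ≤ B)} = Ω ∩ {y | B < f y} := by ext; simp
    rw [this]
    exact hΩ.inter (isOpen_lt continuous_const hf)
  by_contra hc
  have : x ∈ {y | ¬ (y ∈ Ω → f y ≤ B)} := fun h' => hc (h' hx)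
  rw [hopen.eq_empty_of_measure_zero hae] at this
  exact this

lemma lintegral_ofReal_le_of_le_mean {u ψ : ℝ → ℝ} {l : ℝ} (hl : 0 < l) (hψ : Continuous ψ)
    (hψ0 : ∀ t, 0 ≤ ψ t) (h : ∀ t ∈ Icc 0 l, u t ≤ l⁻¹ * ∫ z in (0)..l, ψ z) :
    ∫⁻ t in Ioo 0 l, ENNReal.ofReal (u t) ≤ ∫⁻ t in Ioo 0 l, ENNReal.ofReal (ψ t) := by
  have hI : IntegrableOn ψ (Ioo 0 l) := hψ.integrableOn_Ioc.mono_set Ioo_subset_Ioc_self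
  calc ∫⁻ t in Ioo 0 l, ENNReal.ofReal (u t)
      ≤ ∫⁻ _ in Ioo 0 l, ENNReal.ofReal (l⁻¹ * ∫ z in (0)..l, ψ z) :=
        setLIntegral_mono measurable_const fun t ht =>
          ENNReal.ofReal_le_ofReal (h t (Ioo_subset_Icc_self ht))
    _ = ENNReal.ofReal (∫ z in (0)..l, ψ z) := by
        rw [setLIntegral_const, Real.volume_Ioo, sub_zero, ← ENNReal.ofReal_mul' hl.le]
        congr 1
        field_simp
    _ = _ := by
        rw [intervalIntegral.integral_of_le hl.le, integral_Ioc_eq_integral_Ioo,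
          ofReal_integral_eq_lintegral_ofReal hI (Filter.Eventually.of_forall hψ0)]

lemma exists_balanced_segment {n : ℕ} {E : Type*} [NormedAddCommGroup E] [NormedSpace ℝ E]
    [CompleteSpace E] {H : (Fin n → ℝ) → E} (hH : ContDiff ℝ 2 H) {Ω : Set (Fin n → ℝ)} {M : ℝ}
    (hM : ∀ x ∈ Ω, ‖fderiv ℝ (fderiv ℝ H) x‖ ≤ M) {e : Fin n → ℝ} (he : ‖e‖ ≤ 1) {ε h : ℝ}
    (hε : 0 < ε) (hεh : ε ≤ h) (hh : h ≤ 1) {y : Fin n → ℝ}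
    (hy : ∀ t ∈ Ioo 0 h, y + t • e ∈ Ω) :
    ∃ l, ε ≤ l ∧ l ≤ h ∧ ((∀ t ∈ Icc (0 : ℝ) l, ‖fderiv ℝ H (y + t • e) e‖ ≤ 10 * (ε * M)) ∨
      ∀ t ∈ Icc (0 : ℝ) l, ‖fderiv ℝ H (y + t • e) e‖ ^ 2 ≤
        (10 / h) ^ 2 * ((l⁻¹ * ∫ z in (0)..l, ‖H (y + z • e)‖) *
          (l⁻¹ * ∫ z in (0)..l,
            (‖H (y + z • e)‖ + ‖fderiv ℝ (fderiv ℝ H) (y + z • e)‖)))) := by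
  have hD : ContDiff ℝ 1 (fderiv ℝ H) := hH.fderiv_right (by norm_num)
  have hD2 : Continuous (fderiv ℝ (fderiv ℝ H)) := hD.continuous_fderiv (by norm_num)
  have hD2n : Continuous fun x => ‖fderiv ℝ (fderiv ℝ H) x‖ :=
    Continuous.norm (E := (Fin n → ℝ) →L[ℝ] (Fin n → ℝ) →L[ℝ] E) hD2
  have hHc := hH.continuous
  have hline : ∀ t : ℝ, HasDerivAt (fun z : ℝ => y + z • e) e t := fun t => by
    simpa using ((hasDerivAt_id t).smul_const e).const_add y
  have hbd : ∀ x, ‖fderiv ℝ (fderiv ℝ H) x e e‖ ≤ ‖fderiv ℝ (fderiv ℝ H) x‖ := by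
    intro x
    calc _ ≤ ‖fderiv ℝ (fderiv ℝ H) x‖ * ‖e‖ * ‖e‖ := ContinuousLinearMap.le_opNorm₂ _ _ _
      _ ≤ ‖fderiv ℝ (fderiv ℝ H) x‖ * 1 * 1 := by gcongr
      _ = _ := by ring
  refine exists_balanced_length (w := fun t => H (y + t • e))
    (w' := fun t => fderiv ℝ H (y + t • e) e)
    (w'' := fun t => fderiv ℝ (fderiv ℝ H) (y + t • e) e e) ?_ ?_ ?_ ?_ ?_ hε hεh hh
    (M := M) ?_
  · intro t
    exact ((hH.differentiable (by norm_num) _).hasFDerivAt).comp_hasDerivAt t (hline t)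
  · intro t
    have := ((hD.differentiable (by norm_num) _).hasFDerivAt).comp_hasDerivAt t (hline t)
    simpa using this.clm_apply (hasDerivAt_const t e)
  · exact ((hD2.clm_apply continuous_const).clm_apply continuous_const).comp
      (continuous_iff_continuousAt.2 fun t => (hline t).continuousAt)
  · exact (hHc.norm.add hD2n).comp
      (continuous_iff_continuousAt.2 fun t => (hline t).continuousAt)
  · intro t
    gcongr
    exact hbd _
  · intro t ht
    exact (hbd _).trans (hM _ (hy t ht))

/-- One-directional interpolation of a first derivative between a function and its second
derivatives, on a set from which segments of a fixed direction and length stay in `Ω`. -/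
lemma eLpNorm_fderiv_apply_le {n : ℕ} {E : Type*} [NormedAddCommGroup E] [NormedSpace ℝ E]
    [CompleteSpace E] {H : (Fin n → ℝ) → E} (hH : ContDiff ℝ 2 H) {S Ω : Set (Fin n → ℝ)}
    (hS : MeasurableSet S) (hΩ : IsOpen Ω) (hΩb : Bornology.IsBounded Ω)
    {e : Fin n → ℝ} (he : ‖e‖ ≤ 1) {h : ℝ} (hh0 : 0 < h) (hh : h ≤ 1)
    (hSΩ : ∀ x ∈ S, ∀ t ∈ Ioo 0 h, x + t • e ∈ Ω) {p r s : ℝ≥0∞} (hp : 1 ≤ p) (hr : 1 ≤ r)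
    (hs : 1 ≤ s) (hrs : r⁻¹ + s⁻¹ = 2 * p⁻¹) {X Y : ℝ} (hX : 0 < X) (hY : 0 < Y)
    (hHX : eLpNorm (fun x => ‖H x‖) r (volume.restrict Ω) ≤ ENNReal.ofReal X)
    (hHY : eLpNorm (fun x => ‖H x‖ + ‖fderiv ℝ (fderiv ℝ H) x‖) s (volume.restrict Ω) ≤
      ENNReal.ofReal Y) :
    eLpNorm (fun x => ‖fderiv ℝ H x e‖) p (volume.restrict S) ≤
      ENNReal.ofReal (60 / h * √(X * Y)) := by
  have hD : ContDiff ℝ 1 (fderiv ℝ H) := hH.fderiv_right (by norm_num)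
  have hDc := hD.continuous
  have hD2 : Continuous (fderiv ℝ (fderiv ℝ H)) := hD.continuous_fderiv (by norm_num)
  have hD2n : Continuous fun x => ‖fderiv ℝ (fderiv ℝ H) x‖ :=
    Continuous.norm (E := (Fin n → ℝ) →L[ℝ] (Fin n → ℝ) →L[ℝ] E) hD2
  have hHc := hH.continuous
  set G : (Fin n → ℝ) → ℝ := fun x => ‖H x‖ + ‖fderiv ℝ (fderiv ℝ H) x‖ with hG
  have hGc : Continuous G := hHc.norm.add hD2n
  have hG0 : ∀ x, 0 ≤ G x := fun x => by positivity
  obtain ⟨M, hM⟩ : ∃ M, ∀ x ∈ Ω, ‖fderiv ℝ (fderiv ℝ H) x‖ ≤ M := by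
    obtain ⟨M, hM⟩ := hΩb.isCompact_closure.bddAbove_image hD2n.continuousOn
    exact ⟨M, fun x hx => hM ⟨x, subset_closure hx, rfl⟩⟩
  have hline : ∀ y : Fin n → ℝ, Continuous fun z : ℝ => y + z • e := fun y => by fun_prop
  have mean_div : ∀ (a : ℝ → ℝ) (l B : ℝ),
      (l⁻¹ * ∫ z in (0)..l, a z) / B = l⁻¹ * ∫ z in (0)..l, a z / B := by
    intro a l B
    rw [intervalIntegral.integral_div]; ring
  have mean_le : ∀ (a : ℝ → ℝ) (l B : ℝ), Continuous a → 0 < l → (∀ z ∈ Ioo 0 l, a z ≤ B) →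
      l⁻¹ * ∫ z in (0)..l, a z ≤ B := by
    intro a l B ha hl hB
    have := intervalIntegral.integral_mono_on_of_le_Ioo (μ := volume) hl.le
      (ha.intervalIntegrable 0 l) (intervalIntegrable_const (c := B)) hB
    rw [inv_mul_le_iff₀ hl]
    simpa using this
  by_cases hp' : p = ∞
  · have hinf : r = ∞ ∧ s = ∞ := by simpa [hp'] using hrs
    have hpt : ∀ x ∈ S, ‖fderiv ℝ H x e‖ ≤ 60 / h * √(X * Y) := by
      intro x hx
      have hle : ∀ ε, 0 < ε → ε ≤ h →
          ‖fderiv ℝ H x e‖ ≤ max (10 * (ε * M)) (10 / h * √(X * Y)) := by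
        intro ε hε hεh
        obtain ⟨l, h1, h2, h3 | h3⟩ := exists_balanced_segment hH hM he hε hεh hh (hSΩ x hx)
        · have := h3 0 ⟨le_rfl, hε.le.trans h1⟩
          simp only [zero_smul, add_zero] at this
          exact le_max_of_le_left this
        · have := h3 0 ⟨le_rfl, hε.le.trans h1⟩
          simp only [zero_smul, add_zero] at this
          refine le_max_of_le_right ?_
          have hl := hε.trans_le h1
          have hα := mean_le (fun z => ‖H (x + z • e)‖) l X (by fun_prop) hl fun z hz =>
            le_of_eLpNorm_top_le hΩ hHc.norm (fun _ => norm_nonneg _) hX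
              (by simpa [hinf.1] using hHX) (hSΩ x hx z ⟨hz.1, hz.2.trans_le h2⟩)
          have hβ := mean_le (fun z => G (x + z • e)) l Y (by fun_prop) hl fun z hz =>
            le_of_eLpNorm_top_le hΩ hGc hG0 hY
              (by simpa [hinf.2] using hHY) (hSΩ x hx z ⟨hz.1, hz.2.trans_le h2⟩)
          have hβ0 : 0 ≤ l⁻¹ * ∫ z in (0)..l, G (x + z • e) :=
            mul_nonneg (by positivity) (intervalIntegral.integral_nonneg hl.le fun _ _ => hG0 _)
          refine abs_le_of_sq_le_sq' (a := ‖fderiv ℝ H x e‖) ?_ (by positivity) |>.2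
          rw [mul_pow, Real.sq_sqrt (by positivity)]
          refine this.trans ?_
          gcongr
      have hlim : Filter.Tendsto (fun ε : ℝ => max (10 * (ε * M)) (10 / h * √(X * Y)))
          (nhdsWithin 0 (Ioi 0)) (nhds (max (10 * (0 * M)) (10 / h * √(X * Y)))) :=
        (Continuous.tendsto (by fun_prop) 0).mono_left nhdsWithin_le_nhds
      have := ge_of_tendsto hlim (b := ‖fderiv ℝ H x e‖) (by
        filter_upwards [Ioc_mem_nhdsGT hh0] with ε hε using hle ε hε.1 hε.2)
      rw [zero_mul, mul_zero, max_eq_right (by positivity)] at this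
      refine this.trans ?_
      gcongr
      norm_num
    rw [hp', eLpNorm_exponent_top]
    refine eLpNormEssSup_le_of_ae_bound ?_
    rw [ae_restrict_iff' hS]
    exact Filter.Eventually.of_forall fun x hx => by simpa using hpt x hx
  have hP : 1 ≤ p.toReal := by simpa using ENNReal.toReal_mono hp' hp
  have hP0 : 0 < p.toReal := by linarith
  set P := p.toReal with hPdef
  set K : ℝ := (10 / h) ^ P * (X * Y) ^ (P / 2) with hK
  have hK0 : 0 < K := by positivity
  have hvol : volume Ω ≠ ∞ := hΩb.measure_lt_top.ne
  set η : ℝ := K / ((volume Ω).toReal + 1) with hη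
  have hη0 : 0 < η := by positivity
  set φ : (Fin n → ℝ) → ℝ := fun x =>
    K * (modularIntegrand r (‖H x‖ / X) + modularIntegrand s (G x / Y)) + η with hφ
  have hmr := continuous_modularIntegrand r
  have hms := continuous_modularIntegrand s
  have hφc : Continuous φ := by fun_prop
  have hnr : ∀ x, 0 ≤ modularIntegrand r (‖H x‖ / X) := fun x =>
    modularIntegrand_nonneg r (by positivity)
  have hns : ∀ x, 0 ≤ modularIntegrand s (G x / Y) := fun x =>
    modularIntegrand_nonneg s (div_nonneg (hG0 x) hY.le)
  have hφ0 : ∀ x, 0 ≤ φ x := fun x =>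
    add_nonneg (mul_nonneg hK0.le (add_nonneg (hnr x) (hns x))) hη0.le
  obtain ⟨ε, hε, hεh, hεM⟩ : ∃ ε, 0 < ε ∧ ε ≤ h ∧ (10 * (ε * |M|)) ^ P ≤ η := by
    have hlim : Filter.Tendsto (fun ε : ℝ => (10 * (ε * |M|)) ^ P)
        (nhdsWithin 0 (Ioi 0)) (nhds ((10 * (0 * |M|)) ^ P)) := by
      refine (Continuous.tendsto ?_ 0).mono_left nhdsWithin_le_nhds
      exact Continuous.rpow_const (by fun_prop) fun _ => Or.inr hP0.le
    rw [zero_mul, mul_zero, Real.zero_rpow hP0.ne'] at hlim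
    obtain ⟨ε, h1, h2⟩ := ((hlim.eventually_le_const hη0).and (Ioc_mem_nhdsGT hh0)).exists
    exact ⟨ε, h2.1, h2.2, h1⟩
  have hmain : ∫⁻ x in S, ENNReal.ofReal (‖fderiv ℝ H x e‖ ^ P) ≤
      2 * ∫⁻ x in Ω, ENNReal.ofReal (φ x) := by
    refine lintegral_le_two_mul_of_segments (e := e) (ε := ε) (h := h) ?_ ?_ hS hΩ.measurableSet
      hε hh0 hSΩ ?_
    · have : Continuous fun x => ‖fderiv ℝ H x e‖ := by fun_prop
      exact (this.rpow_const fun _ => Or.inr hP0.le).measurable.ennreal_ofReal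
    · exact hφc.measurable.ennreal_ofReal
    · intro y hy
      obtain ⟨l, h1, h2, h3⟩ := exists_balanced_segment hH hM he hε hεh hh hy
      have hl := hε.trans_le h1
      refine ⟨l, h1, h2, lintegral_ofReal_le_of_le_mean hl (by fun_prop) (fun _ => hφ0 _) ?_⟩
      have ca : Continuous fun z : ℝ => ‖H (y + z • e)‖ / X := by fun_prop
      have cb : Continuous fun z : ℝ => G (y + z • e) / Y := by fun_prop
      have hmean : l⁻¹ * ∫ z in (0)..l, φ (y + z • e) =
          K * ((l⁻¹ * ∫ z in (0)..l, modularIntegrand r (‖H (y + z • e)‖ / X)) +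
            l⁻¹ * ∫ z in (0)..l, modularIntegrand s (G (y + z • e) / Y)) + η := by
        simp only [hφ]
        have i1 : IntervalIntegrable (fun z : ℝ => modularIntegrand r (‖H (y + z • e)‖ / X))
          volume 0 l := (hmr.comp ca).intervalIntegrable _ _
        have i2 : IntervalIntegrable (fun z : ℝ => modularIntegrand s (G (y + z • e) / Y))
          volume 0 l := (hms.comp cb).intervalIntegrable _ _
        rw [intervalIntegral.integral_add ((i1.add i2).const_mul K) intervalIntegrable_const,
          intervalIntegral.integral_const_mul, intervalIntegral.integral_add i1 i2]
        simp only [intervalIntegral.integral_const, sub_zero, smul_eq_mul]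
        field_simp
      have hA0 : 0 ≤ l⁻¹ * ∫ z in (0)..l, modularIntegrand r (‖H (y + z • e)‖ / X) :=
        mul_nonneg (by positivity) (intervalIntegral.integral_nonneg hl.le fun _ _ => hnr _)
      have hB0 : 0 ≤ l⁻¹ * ∫ z in (0)..l, modularIntegrand s (G (y + z • e) / Y) :=
        mul_nonneg (by positivity) (intervalIntegral.integral_nonneg hl.le fun _ _ => hns _)
      intro t ht
      rw [hmean]
      rcases h3 with h3 | h3
      · calc ‖fderiv ℝ H (y + t • e) e‖ ^ P ≤ (10 * (ε * |M|)) ^ P := by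
              gcongr
              refine (h3 t ht).trans ?_
              gcongr
              exact le_abs_self M
          _ ≤ η := hεM
          _ ≤ _ := le_add_of_nonneg_left (mul_nonneg hK0.le (add_nonneg hA0 hB0))
      · set α := l⁻¹ * ∫ z in (0)..l, ‖H (y + z • e)‖ with hα
        set β := l⁻¹ * ∫ z in (0)..l, G (y + z • e) with hβ
        have hα0 : 0 ≤ α :=
          mul_nonneg (by positivity) (intervalIntegral.integral_nonneg hl.le
            fun _ _ => norm_nonneg _)
        have hβ0 : 0 ≤ β :=
          mul_nonneg (by positivity) (intervalIntegral.integral_nonneg hl.le fun _ _ => hG0 _)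
        have hin : ∀ z ∈ Ioo 0 l, y + z • e ∈ Ω := fun z hz => hy z ⟨hz.1, hz.2.trans_le h2⟩
        have hyoung := rpow_mul_rpow_le_modularIntegrand hr hs hp' hrs
          (x := α / X) (y := β / Y) (by positivity) (by positivity)
          (fun hri => by
            rw [div_le_one hX]
            refine mean_le _ l X (by fun_prop) hl fun z hz => ?_
            exact le_of_eLpNorm_top_le hΩ hHc.norm (fun _ => norm_nonneg _) hX
              (by simpa [hri] using hHX) (hin z hz))
          (fun hsi => by
            rw [div_le_one hY]
            refine mean_le _ l Y (by fun_prop) hl fun z hz => ?_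
            exact le_of_eLpNorm_top_le hΩ hGc hG0 hY (by simpa [hsi] using hHY) (hin z hz))
        calc ‖fderiv ℝ H (y + t • e) e‖ ^ P
            = (‖fderiv ℝ H (y + t • e) e‖ ^ 2) ^ (P / 2) := by
              rw [← Real.rpow_natCast, ← Real.rpow_mul (norm_nonneg _)]
              congr 1; push_cast; ring
          _ ≤ ((10 / h) ^ 2 * (α * β)) ^ (P / 2) := by
              gcongr
              exact h3 t ht
          _ = K * (α / X * (β / Y)) ^ (P / 2) := by
              clear_value α β
              rw [hK, mul_assoc, ← Real.mul_rpow (by positivity) (by positivity),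
                Real.mul_rpow (by positivity) (by positivity)]
              congr 1
              · rw [← Real.rpow_natCast, ← Real.rpow_mul (by positivity)]
                congr 1; push_cast; ring
              · congr 1; field_simp
          _ ≤ K * (modularIntegrand r (α / X) + modularIntegrand s (β / Y)) := by gcongr
          _ ≤ K * ((l⁻¹ * ∫ z in (0)..l, modularIntegrand r (‖H (y + z • e)‖ / X)) +
                l⁻¹ * ∫ z in (0)..l, modularIntegrand s (G (y + z • e) / Y)) := by
              gcongr
              · rw [hα, mean_div]
                exact modularIntegrand_mean_le hr ca (fun _ => by positivity) hl
              · rw [hβ, mean_div]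
                exact modularIntegrand_mean_le hs cb (fun _ => div_nonneg (hG0 _) hY.le) hl
          _ ≤ _ := le_add_of_nonneg_right hη0.le
  have hφint : ∫⁻ x in Ω, ENNReal.ofReal (φ x) ≤ 3 * ENNReal.ofReal K := by
    have e1 : ∀ x, ENNReal.ofReal (φ x) = ENNReal.ofReal K *
        (ENNReal.ofReal (modularIntegrand r (‖H x‖ / X)) +
          ENNReal.ofReal (modularIntegrand s (G x / Y))) + ENNReal.ofReal η := by
      intro x
      rw [hφ, ENNReal.ofReal_add (mul_nonneg hK0.le (add_nonneg (hnr x) (hns x))) hη0.le,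
        ENNReal.ofReal_mul hK0.le, ENNReal.ofReal_add (hnr x) (hns x)]
    simp_rw [e1]
    have m1 : Measurable fun x => ENNReal.ofReal (modularIntegrand r (‖H x‖ / X)) :=
      (hmr.comp (hHc.norm.div_const X)).measurable.ennreal_ofReal
    rw [lintegral_add_right _ measurable_const, lintegral_const_mul' _ _ ENNReal.ofReal_ne_top,
      lintegral_add_left m1, setLIntegral_const]
    have b1 := lintegral_modularIntegrand_le_one hr (fun x => norm_nonneg (H x)) hX hHX
    have b2 := lintegral_modularIntegrand_le_one hs hG0 hY hHY
    have b3 : ENNReal.ofReal η * volume Ω ≤ ENNReal.ofReal K := by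
      rw [← ENNReal.ofReal_toReal hvol, ← ENNReal.ofReal_mul hη0.le]
      refine ENNReal.ofReal_le_ofReal ?_
      have hv : 0 ≤ (volume Ω).toReal := ENNReal.toReal_nonneg
      rw [hη, div_mul_eq_mul_div, div_le_iff₀ (by positivity)]
      nlinarith
    calc _ ≤ ENNReal.ofReal K * (1 + 1) + ENNReal.ofReal K := by gcongr
      _ = _ := by ring
  rw [eLpNorm_eq_lintegral_rpow_enorm_toReal (zero_lt_one.trans_le hp).ne' hp', one_div,
    ENNReal.rpow_inv_le_iff hP0]
  calc ∫⁻ x in S, ‖‖fderiv ℝ H x e‖‖ₑ ^ p.toReal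
      = ∫⁻ x in S, ENNReal.ofReal (‖fderiv ℝ H x e‖ ^ P) := by
        refine lintegral_congr fun x => ?_
        rw [Real.enorm_of_nonneg (norm_nonneg _), ENNReal.ofReal_rpow_of_nonneg (norm_nonneg _)
          hP0.le]
    _ ≤ 2 * (3 * ENNReal.ofReal K) := hmain.trans (by gcongr)
    _ = ENNReal.ofReal (6 * K) := by
        clear_value K
        rw [ENNReal.ofReal_mul (by norm_num), ENNReal.ofReal_ofNat, ← mul_assoc]
        norm_num
    _ ≤ ENNReal.ofReal ((60 / h * √(X * Y)) ^ P) := by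
        refine ENNReal.ofReal_le_ofReal ?_
        have e2 : (60 / h * √(X * Y)) ^ P = 6 ^ P * K := by
          rw [hK, show 60 / h * √(X * Y) = 6 * ((10 / h) * √(X * Y)) by ring,
            Real.mul_rpow (by norm_num) (by positivity), Real.mul_rpow (by positivity)
            (by positivity), Real.sqrt_eq_rpow, ← Real.rpow_mul (by positivity)]
          congr 3; ring
        rw [e2]
        gcongr
        calc (6 : ℝ) = 6 ^ (1 : ℝ) := by simp
          _ ≤ 6 ^ P := Real.rpow_le_rpow_of_exponent_le (by norm_num) hP
    _ = _ := by rw [ENNReal.ofReal_rpow_of_nonneg (by positivity) hP0.le]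

/-- Near every point of its closure, a smooth domain contains the short segments issued from its
points in all directions close to a fixed one. -/
lemma SmoothDomain.exists_segment_mem {n : ℕ} {Ω : Set (Fin n → ℝ)} (hΩ : SmoothDomain Ω)
    {x₀ : Fin n → ℝ} (hx₀ : x₀ ∈ closure Ω) :
    ∃ U, IsOpen U ∧ x₀ ∈ U ∧ ∃ h δ : ℝ, ∃ e₀ : Fin n → ℝ, 0 < h ∧ h ≤ 1 ∧ 0 < δ ∧
      ∀ e, ‖e - e₀‖ ≤ δ → ‖e‖ ≤ 1 ∧ ∀ x ∈ Ω ∩ U, ∀ t ∈ Ioo 0 h, x + t • e ∈ Ω := by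
  obtain ⟨hO, -, F, hF, rfl, hd⟩ := hΩ
  have hstep : ∀ (ρ : ℝ) (x e : Fin n → ℝ) (t : ℝ), x ∈ Metric.ball x₀ (ρ / 2) → ‖e‖ ≤ 1 →
      t ∈ Ico 0 (min 1 (ρ / 2)) → x + t • e ∈ Metric.ball x₀ ρ := by
    intro ρ x e t hx he ht
    have h1 : ‖t • e‖ < ρ / 2 := by
      rw [norm_smul, Real.norm_of_nonneg ht.1]
      calc t * ‖e‖ ≤ t * 1 := mul_le_mul_of_nonneg_left he ht.1
        _ < ρ / 2 := by rw [mul_one]; exact ht.2.trans_le (min_le_right _ _)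
    rw [mem_ball_iff_norm] at hx ⊢
    calc ‖x + t • e - x₀‖ = ‖(x - x₀) + t • e‖ := by congr 1; abel
      _ ≤ ‖x - x₀‖ + ‖t • e‖ := norm_add_le _ _
      _ < ρ := by linarith
  by_cases hx : x₀ ∈ {x | F x < 0}
  · obtain ⟨ρ, hρ, hb⟩ := Metric.isOpen_iff.1 hO x₀ hx
    refine ⟨Metric.ball x₀ (ρ / 2), Metric.isOpen_ball, Metric.mem_ball_self (by positivity),
      min 1 (ρ / 2), 1, 0, by positivity, min_le_left _ _, one_pos, fun e he => ?_⟩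
    rw [sub_zero] at he
    exact ⟨he, fun x hx t ht => hb (hstep ρ x e t hx.2 he (Ioo_subset_Ico_self ht))⟩
  have hfr : x₀ ∈ frontier {x | F x < 0} := by
    rw [hO.frontier_eq]; exact ⟨hx₀, hx⟩
  obtain ⟨e₀, he₀, hA⟩ : ∃ e₀ : Fin n → ℝ, ‖e₀‖ ≤ 1 / 2 ∧ fderiv ℝ F x₀ e₀ < 0 := by
    obtain ⟨v, hv⟩ : ∃ v, fderiv ℝ F x₀ v ≠ 0 := by
      by_contra! hc
      exact hd x₀ hfr (ContinuousLinearMap.ext hc)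
    have hv0 : 0 < ‖v‖ := norm_pos_iff.2 fun h0 => hv (by simp [h0])
    have key : ∀ w : Fin n → ℝ, ‖w‖ = ‖v‖ → fderiv ℝ F x₀ w < 0 →
        ∃ e₀ : Fin n → ℝ, ‖e₀‖ ≤ 1 / 2 ∧ fderiv ℝ F x₀ e₀ < 0 := by
      intro w hw hneg
      refine ⟨(2 * ‖v‖)⁻¹ • w, ?_, ?_⟩
      · rw [norm_smul, hw, Real.norm_of_nonneg (by positivity)]
        apply le_of_eq; field_simp
      · rw [map_smul, smul_eq_mul]
        exact mul_neg_of_pos_of_neg (by positivity) hneg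
    rcases lt_or_gt_of_ne hv with h1 | h1
    · exact key v rfl h1
    · exact key (-v) (norm_neg v) (by rw [map_neg]; linarith)
  have hcont : Continuous fun y : (Fin n → ℝ) × (Fin n → ℝ) => fderiv ℝ F y.1 y.2 :=
    ((hF.continuous_fderiv (by simp)).comp continuous_fst).clm_apply continuous_snd
  obtain ⟨ρ, hρ, hb⟩ := Metric.isOpen_iff.1 (isOpen_lt hcont continuous_const) (x₀, e₀) hA
  refine ⟨Metric.ball x₀ (ρ / 2), Metric.isOpen_ball, Metric.mem_ball_self (by positivity),
    min 1 (ρ / 2), min (1 / 2) (ρ / 2), e₀, by positivity, min_le_left _ _, by positivity,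
    fun e he => ?_⟩
  have he1 : ‖e‖ ≤ 1 := by
    have := norm_le_norm_add_norm_sub' e e₀
    have := he.trans (min_le_left _ _)
    linarith
  refine ⟨he1, fun x hx t ht => ?_⟩
  have hneg : ∀ z ∈ Icc 0 t, fderiv ℝ F (x + z • e) e < 0 := by
    intro z hz
    suffices h' : (x + z • e, e) ∈ Metric.ball (x₀, e₀) ρ from hb h'
    rw [← ball_prod_same]
    refine ⟨hstep ρ x e z hx.2 he1 ⟨hz.1, hz.2.trans_lt ht.2⟩, ?_⟩
    rw [mem_ball_iff_norm]
    have := he.trans (min_le_right _ _)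
    exact this.trans_lt (by linarith)
  have hder : ∀ z : ℝ, HasDerivAt (fun z : ℝ => F (x + z • e)) (fderiv ℝ F (x + z • e) e) z := by
    intro z
    have hl : HasDerivAt (fun z : ℝ => x + z • e) e z := by
      simpa using ((hasDerivAt_id z).smul_const e).const_add x
    exact ((hF.differentiable (by simp) _).hasFDerivAt).comp_hasDerivAt z hl
  have hanti := antitoneOn_of_deriv_nonpos (convex_Icc 0 t)
    (fun z _ => (hder z).continuousAt.continuousWithinAt)
    (fun z _ => (hder z).differentiableAt.differentiableWithinAt)
    (fun z hz => by
      rw [(hder z).deriv]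
      exact (hneg z (interior_subset hz)).le)
  have := hanti (left_mem_Icc.2 ht.1.le) (right_mem_Icc.2 ht.1.le) ht.1.le
  simp only [zero_smul, add_zero] at this
  exact this.trans_lt hx.1

lemma eLpNorm_restrict_le_sum {X ι : Type*} [MeasurableSpace X] {μ : Measure X} {t : Finset ι}
    {S : ι → Set X} (hS : ∀ i ∈ t, MeasurableSet (S i)) {Ω : Set X} (hΩ : Ω ⊆ ⋃ i ∈ t, S i)
    {f : X → ℝ} (hf : AEStronglyMeasurable f μ) {p : ℝ≥0∞} (hp : 1 ≤ p) :
    eLpNorm f p (μ.restrict Ω) ≤ ∑ i ∈ t, eLpNorm f p (μ.restrict (S i)) := by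
  have hU : MeasurableSet (⋃ i ∈ t, S i) := t.measurableSet_biUnion hS
  calc eLpNorm f p (μ.restrict Ω) ≤ eLpNorm f p (μ.restrict (⋃ i ∈ t, S i)) :=
        eLpNorm_mono_measure _ (Measure.restrict_mono hΩ le_rfl)
    _ = eLpNorm ((⋃ i ∈ t, S i).indicator f) p μ :=
        (eLpNorm_indicator_eq_eLpNorm_restrict hU).symm
    _ ≤ eLpNorm (∑ i ∈ t, (S i).indicator fun x => ‖f x‖) p μ := by
        refine eLpNorm_mono fun x => ?_
        rw [Finset.sum_apply, Real.norm_of_nonneg (Finset.sum_nonneg fun i _ =>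
          indicator_nonneg (fun _ _ => norm_nonneg _) _)]
        by_cases hx : x ∈ ⋃ i ∈ t, S i
        · rw [indicator_of_mem hx]
          simp only [mem_iUnion] at hx
          obtain ⟨i, hi, hxi⟩ := hx
          calc ‖f x‖ = (S i).indicator (fun x => ‖f x‖) x := by rw [indicator_of_mem hxi]
            _ ≤ _ := Finset.single_le_sum (f := fun i => (S i).indicator (fun x => ‖f x‖) x)
              (fun i _ => indicator_nonneg (fun _ _ => norm_nonneg _) _) hi
        · rw [indicator_of_notMem hx, norm_zero]
          exact Finset.sum_nonneg fun i _ => indicator_nonneg (fun _ _ => norm_nonneg _) _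
    _ ≤ ∑ i ∈ t, eLpNorm ((S i).indicator fun x => ‖f x‖) p μ :=
        eLpNorm_sum_le (fun i hi => hf.norm.indicator (hS i hi)) hp
    _ = _ := by
        refine Finset.sum_congr rfl fun i hi => ?_
        rw [eLpNorm_indicator_eq_eLpNorm_restrict (hS i hi)]
        exact eLpNorm_norm f

lemma eLpNorm_lt_top_of_continuous {n : ℕ} {Ω : Set (Fin n → ℝ)} (hΩ : Bornology.IsBounded Ω)
    (hΩm : MeasurableSet Ω) {f : (Fin n → ℝ) → ℝ} (hf : Continuous f) (p : ℝ≥0∞) :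
    eLpNorm f p (volume.restrict Ω) < ∞ := by
  have : IsFiniteMeasure (volume.restrict Ω) := ⟨by simpa using hΩ.measure_lt_top⟩
  obtain ⟨M, hM⟩ := hΩ.isCompact_closure.exists_bound_of_continuousOn hf.continuousOn
  refine (MemLp.of_bound hf.aestronglyMeasurable M ?_).2
  rw [ae_restrict_iff' hΩm]
  exact Filter.Eventually.of_forall fun x hx => hM x (subset_closure hx)

lemma opNorm_le_sum_single {n : ℕ} {E : Type*} [NormedAddCommGroup E] [NormedSpace ℝ E]
    (L : (Fin n → ℝ) →L[ℝ] E) : ‖L‖ ≤ ∑ i, ‖L (Pi.single i 1)‖ := by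
  refine L.opNorm_le_bound (Finset.sum_nonneg fun _ _ => norm_nonneg _) fun x => ?_
  calc ‖L x‖ = ‖∑ i, x i • L (Pi.single i 1)‖ := by
        conv_lhs => rw [pi_eq_sum_univ' x]
        simp [map_sum]
    _ ≤ ∑ i, ‖L (Pi.single i 1)‖ * ‖x‖ := by
        refine norm_sum_le_of_le _ fun i _ => ?_
        rw [norm_smul, mul_comm]
        gcongr
        exact norm_le_pi_norm x i
    _ = _ := by rw [Finset.sum_mul]

lemma exists_eLpNorm_fderiv_le {n : ℕ} {Ω : Set (Fin n → ℝ)} (hΩ : SmoothDomain Ω) :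
    ∃ C : ℝ, 0 ≤ C ∧ ∀ (E : Type) [NormedAddCommGroup E] [NormedSpace ℝ E] [CompleteSpace E]
      (H : (Fin n → ℝ) → E) (p r s : ℝ≥0∞) (X Y : ℝ), ContDiff ℝ 2 H → 1 ≤ p → 1 ≤ r → 1 ≤ s →
      r⁻¹ + s⁻¹ = 2 * p⁻¹ → 0 < X → 0 < Y →
      eLpNorm (fun x => ‖H x‖) r (volume.restrict Ω) ≤ ENNReal.ofReal X →
      eLpNorm (fun x => ‖H x‖ + ‖fderiv ℝ (fderiv ℝ H) x‖) s (volume.restrict Ω) ≤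
        ENNReal.ofReal Y →
      eLpNorm (fun x => ‖fderiv ℝ H x‖) p (volume.restrict Ω) ≤
        ENNReal.ofReal (C * √(X * Y)) := by
  choose! U hU hxU h δ e₀ hh0 hh hδ hseg using fun x₀ (hx₀ : x₀ ∈ closure Ω) =>
    hΩ.exists_segment_mem hx₀
  obtain ⟨hO, hb, -⟩ := hΩ
  obtain ⟨t, ht, hcov⟩ := hb.isCompact_closure.elim_nhds_subcover U
    fun x hx => (hU x hx).mem_nhds (hxU x hx)
  have hpos : ∀ x ∈ t, 0 ≤ (δ x)⁻¹ * ∑ _i : Fin n, 2 * (60 / h x) := fun x hx => by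
    have := hh0 x (ht x hx)
    have := hδ x (ht x hx)
    positivity
  refine ⟨∑ x ∈ t, (δ x)⁻¹ * ∑ _i : Fin n, 2 * (60 / h x), Finset.sum_nonneg hpos, ?_⟩
  intro E _ _ _ H p r s X Y hH hp hr hs hrs hX hY hHX hHY
  have hDc : Continuous (fderiv ℝ H) := hH.continuous_fderiv (by norm_num)
  have hDe : ∀ e, Continuous fun x => ‖fderiv ℝ H x e‖ := fun e =>
    (hDc.clm_apply continuous_const).norm
  have hSm : ∀ x ∈ t, MeasurableSet (Ω ∩ U x) := fun x hx =>
    (hO.inter (hU x (ht x hx))).measurableSet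
  have hcov' : Ω ⊆ ⋃ x ∈ t, Ω ∩ U x := fun y hy => by
    have := hcov (subset_closure hy)
    simp only [mem_iUnion] at this ⊢
    obtain ⟨x, hx, hxy⟩ := this
    exact ⟨x, hx, hy, hxy⟩
  refine (eLpNorm_restrict_le_sum hSm hcov' hDc.norm.aestronglyMeasurable hp).trans ?_
  rw [Finset.sum_mul, ENNReal.ofReal_sum_of_nonneg fun x hx =>
    mul_nonneg (hpos x hx) (Real.sqrt_nonneg _)]
  refine Finset.sum_le_sum fun x hx => ?_
  have hδx := hδ x (ht x hx)
  have hhx := hh0 x (ht x hx)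
  have hdir : ∀ e, ‖e - e₀ x‖ ≤ δ x → eLpNorm (fun y => ‖fderiv ℝ H y e‖) p
      (volume.restrict (Ω ∩ U x)) ≤ ENNReal.ofReal (60 / h x * √(X * Y)) := fun e he =>
    eLpNorm_fderiv_apply_le hH (hSm x hx) hO hb (hseg x (ht x hx) e he).1 hhx (hh x (ht x hx))
      (hseg x (ht x hx) e he).2 hp hr hs hrs hX hY hHX hHY
  set e : Fin n → Fin n → ℝ := fun i => e₀ x + δ x • Pi.single i 1 with he
  have hpt : ∀ y, ‖fderiv ℝ H y‖ ≤
      ((δ x)⁻¹ • ∑ i, ((fun y => ‖fderiv ℝ H y (e i)‖) + fun y => ‖fderiv ℝ H y (e₀ x)‖)) y := by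
    intro y
    rw [Pi.smul_apply, Finset.sum_apply, smul_eq_mul, Finset.mul_sum]
    refine (opNorm_le_sum_single _).trans (Finset.sum_le_sum fun i _ => ?_)
    rw [le_inv_mul_iff₀ hδx]
    calc δ x * ‖fderiv ℝ H y (Pi.single i 1)‖
        = ‖fderiv ℝ H y (e i) - fderiv ℝ H y (e₀ x)‖ := by
          rw [he, map_add, map_smul, add_sub_cancel_left, norm_smul, Real.norm_of_nonneg hδx.le]
      _ ≤ _ := norm_sub_le _ _
  calc eLpNorm (fun y => ‖fderiv ℝ H y‖) p (volume.restrict (Ω ∩ U x))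
      ≤ eLpNorm ((δ x)⁻¹ • ∑ i, ((fun y => ‖fderiv ℝ H y (e i)‖) +
          fun y => ‖fderiv ℝ H y (e₀ x)‖)) p (volume.restrict (Ω ∩ U x)) :=
        eLpNorm_mono_real fun y => by rw [norm_norm]; exact hpt y
    _ ≤ ENNReal.ofReal (δ x)⁻¹ * ∑ i : Fin n, (ENNReal.ofReal (60 / h x * √(X * Y)) +
          ENNReal.ofReal (60 / h x * √(X * Y))) := by
        rw [eLpNorm_const_smul, Real.enorm_of_nonneg (inv_nonneg.2 hδx.le)]
        gcongr
        refine (eLpNorm_sum_le (fun i _ => ((hDe _).add (hDe _)).aestronglyMeasurable) hp).trans ?_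
        refine Finset.sum_le_sum fun i _ => (eLpNorm_add_le (hDe _).aestronglyMeasurable
          (hDe _).aestronglyMeasurable hp).trans (add_le_add (hdir _ ?_) (hdir _ ?_))
        · rw [he, add_sub_cancel_left, norm_smul, Real.norm_of_nonneg hδx.le, Pi.norm_single]
          simp
        · simpa using hδx.le
    _ = _ := by
        have h0 : 0 ≤ 60 / h x * √(X * Y) := by positivity
        rw [← ENNReal.ofReal_add h0 h0, ← ENNReal.ofReal_sum_of_nonneg fun _ _ => add_nonneg h0 h0,
          ← ENNReal.ofReal_mul (inv_nonneg.2 hδx.le)]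
        congr 1
        rw [mul_assoc, Finset.sum_mul]
        congr 1
        exact Finset.sum_congr rfl fun _ _ => by ring

/-- The first derivative is controlled by the geometric mean of the function and its second
derivatives, with exponents in harmonic mean position. -/
lemma exists_eLpNorm_fderiv_sq_le {n : ℕ} {Ω : Set (Fin n → ℝ)} (hΩ : SmoothDomain Ω) :
    ∃ C : ℝ≥0, ∀ (E : Type) [NormedAddCommGroup E] [NormedSpace ℝ E] [CompleteSpace E]
      (H : (Fin n → ℝ) → E) (p r s : ℝ≥0∞), ContDiff ℝ 2 H → 1 ≤ p → 1 ≤ r → 1 ≤ s →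
      r⁻¹ + s⁻¹ = 2 * p⁻¹ →
      eLpNorm (fun x => ‖fderiv ℝ H x‖) p (volume.restrict Ω) ^ 2 ≤
        C * (eLpNorm (fun x => ‖H x‖) r (volume.restrict Ω) *
          eLpNorm (fun x => ‖H x‖ + ‖fderiv ℝ (fderiv ℝ H) x‖) s (volume.restrict Ω)) := by
  obtain ⟨C, hC, h⟩ := exists_eLpNorm_fderiv_le hΩ
  refine ⟨(C ^ 2).toNNReal, ?_⟩
  intro E _ _ _ H p r s hH hp hr hs hrs
  obtain ⟨hO, hb, -⟩ := hΩ
  have hD : ContDiff ℝ 1 (fderiv ℝ H) := hH.fderiv_right (by norm_num)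
  have hD2 : Continuous (fderiv ℝ (fderiv ℝ H)) := hD.continuous_fderiv (by norm_num)
  have hD2n : Continuous fun x => ‖fderiv ℝ (fderiv ℝ H) x‖ :=
    Continuous.norm (E := (Fin n → ℝ) →L[ℝ] (Fin n → ℝ) →L[ℝ] E) hD2
  have hA := eLpNorm_lt_top_of_continuous hb hO.measurableSet hH.continuous.norm r
  have hB : eLpNorm (fun x => ‖H x‖ + ‖fderiv ℝ (fderiv ℝ H) x‖) s (volume.restrict Ω) < ∞ :=
    eLpNorm_lt_top_of_continuous hb hO.measurableSet (hH.continuous.norm.add hD2n) s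
  set A := eLpNorm (fun x => ‖H x‖) r (volume.restrict Ω)
  set B := eLpNorm (fun x => ‖H x‖ + ‖fderiv ℝ (fderiv ℝ H) x‖) s (volume.restrict Ω)
  have hlim : Filter.Tendsto
      (fun ε : ℝ => ENNReal.ofReal (C * √((A.toReal + ε) * (B.toReal + ε))))
      (nhdsWithin 0 (Ioi 0))
      (nhds (ENNReal.ofReal (C * √((A.toReal + 0) * (B.toReal + 0))))) :=
    ((ENNReal.continuous_ofReal.comp (by fun_prop)).tendsto 0).mono_left nhdsWithin_le_nhds
  have hle := ge_of_tendsto hlim (b := eLpNorm (fun x => ‖fderiv ℝ H x‖) p (volume.restrict Ω)) (by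
    filter_upwards [self_mem_nhdsWithin] with ε hε
    have hε : 0 < ε := hε
    have hA0 : 0 ≤ A.toReal := ENNReal.toReal_nonneg
    have hB0 : 0 ≤ B.toReal := ENNReal.toReal_nonneg
    refine h E H p r s _ _ hH hp hr hs hrs (by positivity) (by positivity) ?_ ?_
    · exact (ENNReal.le_ofReal_iff_toReal_le hA.ne (by positivity)).2 (by linarith)
    · exact (ENNReal.le_ofReal_iff_toReal_le hB.ne (by positivity)).2 (by linarith))
  simp only [add_zero] at hle
  calc _ ≤ ENNReal.ofReal (C * √(A.toReal * B.toReal)) ^ 2 := by gcongr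
    _ = ENNReal.ofReal (C ^ 2) * (ENNReal.ofReal A.toReal * ENNReal.ofReal B.toReal) := by
        rw [← ENNReal.ofReal_pow (by positivity), mul_pow, Real.sq_sqrt (by positivity),
          ENNReal.ofReal_mul (by positivity), ENNReal.ofReal_mul (by positivity)]
    _ = _ := by rw [ENNReal.ofReal_toReal hA.ne, ENNReal.ofReal_toReal hB.ne]; rfl

lemma eLpNorm_sq_le_mul {X : Type*} [MeasurableSpace X] {μ : Measure X} {u : X → ℝ}
    (hu : AEStronglyMeasurable u μ) {p r s : ℝ≥0∞} (hrs : r⁻¹ + s⁻¹ = 2 * p⁻¹) :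
    eLpNorm u p μ ^ 2 ≤ eLpNorm u r μ * eLpNorm u s μ := by
  have hhalf : ENNReal.ofReal (1 / 2) = 2⁻¹ := by
    rw [one_div, ENNReal.ofReal_inv_of_pos (by norm_num)]; simp
  have key : ∀ t : ℝ≥0∞, eLpNorm (fun x => ‖u x‖ ^ (1 / 2 : ℝ)) (2 * t) μ =
      eLpNorm u t μ ^ (1 / 2 : ℝ) := by
    intro t
    rw [eLpNorm_norm_rpow u (by norm_num : (0 : ℝ) < 1 / 2), hhalf, mul_comm 2 t, mul_assoc,
      ENNReal.mul_inv_cancel (by norm_num) (by norm_num), mul_one]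
  have htr : HolderTriple (2 * r) (2 * s) p := ⟨by
    rw [ENNReal.mul_inv (by simp) (by simp), ENNReal.mul_inv (by simp) (by simp), ← mul_add, hrs,
      ← mul_assoc, ENNReal.inv_mul_cancel (by norm_num) (by norm_num), one_mul]⟩
  have hm : AEStronglyMeasurable (fun x => ‖u x‖ ^ (1 / 2 : ℝ)) μ :=
    (Real.continuous_rpow_const (by norm_num)).comp_aestronglyMeasurable hu.norm
  have hH := eLpNorm_smul_le_mul_eLpNorm hm hm (p := 2 * r) (q := 2 * s) (r := p)
  rw [key, key] at hH
  have hfun : ((fun x => ‖u x‖ ^ (1 / 2 : ℝ)) • fun x => ‖u x‖ ^ (1 / 2 : ℝ)) =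
      fun x => ‖u x‖ := by
    ext x
    simp only [Pi.smul_apply', smul_eq_mul]
    rw [← Real.rpow_add_of_nonneg (norm_nonneg _) (by norm_num) (by norm_num)]
    norm_num
  rw [hfun, eLpNorm_norm, ← ENNReal.mul_rpow_of_nonneg _ _ (by norm_num)] at hH
  calc eLpNorm u p μ ^ 2 ≤ ((eLpNorm u r μ * eLpNorm u s μ) ^ (1 / 2 : ℝ)) ^ 2 := by gcongr
    _ = _ := by
      rw [← ENNReal.rpow_natCast, ← ENNReal.rpow_mul]
      norm_num

lemma exists_eLpNorm_iteratedFDeriv_sq_le {n : ℕ} {Ω : Set (Fin n → ℝ)} (hΩ : SmoothDomain Ω) :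
    ∃ C : ℝ≥0, ∀ (k : ℕ) (u : (Fin n → ℝ) → ℝ) (p r s : ℝ≥0∞), ContDiff ℝ (k + 2 : ℕ) u →
      1 ≤ p → 1 ≤ r → 1 ≤ s → r⁻¹ + s⁻¹ = 2 * p⁻¹ →
      eLpNorm (fun x => ‖iteratedFDeriv ℝ (k + 1) u x‖) p (volume.restrict Ω) ^ 2 ≤
        C * (eLpNorm (fun x => ‖iteratedFDeriv ℝ k u x‖) r (volume.restrict Ω) *
          eLpNorm (fun x => ‖iteratedFDeriv ℝ k u x‖ + ‖iteratedFDeriv ℝ (k + 2) u x‖) s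
            (volume.restrict Ω)) := by
  obtain ⟨C, hC⟩ := exists_eLpNorm_fderiv_sq_le hΩ
  have hC' : ∀ (E E' : Type) [NormedAddCommGroup E] [NormedSpace ℝ E] [CompleteSpace E]
      [NormedAddCommGroup E'] [NormedSpace ℝ E'] (I : ((Fin n → ℝ) →L[ℝ] E) ≃ₗᵢ[ℝ] E')
      (H : (Fin n → ℝ) → E) (p r s : ℝ≥0∞), ContDiff ℝ 2 H → 1 ≤ p → 1 ≤ r → 1 ≤ s →
      r⁻¹ + s⁻¹ = 2 * p⁻¹ →
      eLpNorm (fun x => ‖fderiv ℝ H x‖) p (volume.restrict Ω) ^ 2 ≤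
        C * (eLpNorm (fun x => ‖H x‖) r (volume.restrict Ω) *
          eLpNorm (fun x => ‖H x‖ + ‖fderiv ℝ (I ∘ fderiv ℝ H) x‖) s (volume.restrict Ω)) := by
    intro E E' _ _ _ _ _ I H p r s hH hp hr hs hrs
    have hI : ∀ x, ‖fderiv ℝ (I ∘ fderiv ℝ H) x‖ = ‖fderiv ℝ (fderiv ℝ H) x‖ := fun x => by
      rw [LinearIsometryEquiv.comp_fderiv]
      exact LinearIsometry.norm_toContinuousLinearMap_comp I.toLinearIsometry
    simp only [hI]
    exact hC E H p r s hH hp hr hs hrs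
  refine ⟨C, fun k u p r s hu hp hr hs hrs => ?_⟩
  have hH : ContDiff ℝ 2 (iteratedFDeriv ℝ k u) :=
    hu.iteratedFDeriv_right (by norm_cast; lia)
  have := hC' _ _ (continuousMultilinearCurryLeftEquiv ℝ (fun _ : Fin (k + 1) => Fin n → ℝ)
    ℝ).symm (iteratedFDeriv ℝ k u) p r s hH hp hr hs hrs
  rw [← iteratedFDeriv_succ_eq_comp_left] at this
  simpa only [norm_fderiv_iteratedFDeriv] using this

/-- The sum of the `L^p` norms of the derivatives of order between `a` and `b`. -/
def derivNorm {n : ℕ} (a b : ℕ) (p : ℝ≥0∞) (Ω : Set (Fin n → ℝ)) (u : (Fin n → ℝ) → ℝ) : ℝ≥0∞ :=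
  ∑ i ∈ Finset.Icc a b, eLpNorm (fun x => ‖iteratedFDeriv ℝ i u x‖) p (volume.restrict Ω)

lemma eLpNorm_iteratedFDeriv_le_derivNorm {n a b i : ℕ} (ha : a ≤ i) (hb : i ≤ b) (p : ℝ≥0∞)
    (Ω : Set (Fin n → ℝ)) (u : (Fin n → ℝ) → ℝ) :
    eLpNorm (fun x => ‖iteratedFDeriv ℝ i u x‖) p (volume.restrict Ω) ≤ derivNorm a b p Ω u :=
  Finset.single_le_sum (f := fun i => eLpNorm (fun x => ‖iteratedFDeriv ℝ i u x‖) p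
    (volume.restrict Ω)) (fun _ _ => zero_le) (Finset.mem_Icc.2 ⟨ha, hb⟩)

lemma derivNorm_lt_top {n : ℕ} {Ω : Set (Fin n → ℝ)} (hΩ : SmoothDomain Ω) (a b : ℕ) (p : ℝ≥0∞)
    {u : (Fin n → ℝ) → ℝ} (hu : ContDiff ℝ b u) : derivNorm a b p Ω u < ∞ := by
  refine ENNReal.sum_lt_top.2 fun i hi => ?_
  exact eLpNorm_lt_top_of_continuous hΩ.2.1 hΩ.1.measurableSet
    (hu.continuous_iteratedFDeriv (by exact_mod_cast (Finset.mem_Icc.1 hi).2)).norm p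

/-- Log-convexity of the sums of norms of derivatives, in the top order and the inverse exponent. -/
lemma exists_derivNorm_sq_le {n : ℕ} {Ω : Set (Fin n → ℝ)} (hΩ : SmoothDomain Ω) (N : ℕ) :
    ∃ K : ℝ≥0, ∀ (a b : ℕ) (u : (Fin n → ℝ) → ℝ) (p r s : ℝ≥0∞), a ≤ b → b ≤ N →
      ContDiff ℝ (b + 2 : ℕ) u → 1 ≤ p → 1 ≤ r → 1 ≤ s → r⁻¹ + s⁻¹ = 2 * p⁻¹ →
      derivNorm a (b + 1) p Ω u ^ 2 ≤
        K * (derivNorm a b r Ω u * derivNorm a (b + 2) s Ω u) := by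
  obtain ⟨C, hC⟩ := exists_eLpNorm_iteratedFDeriv_sq_le hΩ
  refine ⟨(N + 2) ^ 2 * (C + 1), ?_⟩
  intro a b u p r s hab hbN hu hp hr hs hrs
  set R := derivNorm a b r Ω u
  set S := derivNorm a (b + 2) s Ω u with hS
  have hterm : ∀ i ∈ Finset.Icc a (b + 1),
      eLpNorm (fun x => ‖iteratedFDeriv ℝ i u x‖) p (volume.restrict Ω) ≤
        ((C + 1) * (R * S)) ^ (1 / 2 : ℝ) := by
    intro i hi
    rw [Finset.mem_Icc] at hi
    have hci : ∀ j ≤ b + 2, Continuous fun x => ‖iteratedFDeriv ℝ j u x‖ := fun j hj =>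
      (hu.continuous_iteratedFDeriv (by exact_mod_cast hj)).norm
    rw [one_div, ENNReal.le_rpow_inv_iff (by norm_num), ENNReal.rpow_ofNat]
    rcases hi.1.eq_or_lt with rfl | hlt
    · calc _ ≤ _ := eLpNorm_sq_le_mul (hci a (by lia)).aestronglyMeasurable hrs
        _ ≤ R * S := mul_le_mul' (eLpNorm_iteratedFDeriv_le_derivNorm le_rfl hab _ _ _)
            (eLpNorm_iteratedFDeriv_le_derivNorm le_rfl (by lia) _ _ _)
        _ ≤ _ := le_mul_of_one_le_left' le_add_self
    · obtain ⟨k, rfl⟩ : ∃ k, i = k + 1 := ⟨i - 1, by lia⟩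
      have := hC k u p r s (hu.of_le (by exact_mod_cast by lia)) hp hr hs hrs
      refine this.trans (mul_le_mul' le_self_add (mul_le_mul' ?_ ?_))
      · exact eLpNorm_iteratedFDeriv_le_derivNorm (by lia) (by lia) _ _ _
      · refine (eLpNorm_add_le (hci k (by lia)).aestronglyMeasurable
          (hci (k + 2) (by lia)).aestronglyMeasurable hs).trans ?_
        rw [hS, derivNorm, ← Finset.sum_pair (f := fun i => eLpNorm
          (fun x => ‖iteratedFDeriv ℝ i u x‖) s (volume.restrict Ω)) (by lia : k ≠ k + 2)]
        refine Finset.sum_le_sum_of_subset fun j hj => ?_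
        simp only [Finset.mem_insert, Finset.mem_singleton] at hj
        rw [Finset.mem_Icc]
        lia
  have hsum := Finset.sum_le_card_nsmul _ _ _ hterm
  calc derivNorm a (b + 1) p Ω u ^ 2
      ≤ (((N + 2 : ℕ) : ℝ≥0∞) * ((C + 1) * (R * S)) ^ (1 / 2 : ℝ)) ^ 2 := by
        gcongr
        refine hsum.trans ?_
        rw [nsmul_eq_mul]
        gcongr
        rw [Nat.card_Icc]
        lia
    _ = _ := by
        rw [mul_pow, ← ENNReal.rpow_natCast (_ ^ (1 / 2 : ℝ)), ← ENNReal.rpow_mul]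
        norm_num
        ring

/-- A log-convex finite sequence is bounded by the larger of its end values. -/
lemma le_max_endpoints_of_sq_le_mul {N : ℕ} {d : ℕ → ℝ} (hd : ∀ j ≤ N, 0 ≤ d j)
    (h : ∀ j, j + 2 ≤ N → d (j + 1) ^ 2 ≤ d j * d (j + 2)) {j : ℕ} (hj : j ≤ N) :
    d j ≤ max (d 0) (d N) := by
  classical
  obtain ⟨i₀, hi₀, hmax⟩ := (Finset.range (N + 1)).exists_max_image d ⟨0, by simp⟩
  simp only [Finset.mem_range, Nat.lt_succ_iff] at hi₀ hmax
  have hex : ∃ i, i ≤ N ∧ d i = d i₀ := ⟨i₀, hi₀, rfl⟩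
  obtain ⟨hiN, hi⟩ := Nat.find_spec hex
  have hmin := fun k => Nat.find_min (m := k) hex
  set i := Nat.find hex
  refine (hmax j hj).trans ?_
  rw [← hi]
  rcases Nat.eq_zero_or_pos i with h0 | h0
  · rw [h0]; exact le_max_left _ _
  rcases hiN.eq_or_lt with hN | hN
  · rw [hN]; exact le_max_right _ _
  exfalso
  obtain ⟨k, hk⟩ : ∃ k, i = k + 1 := ⟨i - 1, by lia⟩
  have h1 : d k < d i := by
    refine lt_of_le_of_ne (hi ▸ hmax k (by lia)) fun he => hmin k (by lia) ⟨by lia, he.trans hi⟩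
  have h2 : d (k + 2) ≤ d i := hi ▸ hmax _ (by lia)
  have h3 := h k (by lia)
  rw [← hk] at h3
  have h4 := hd k (by lia)
  nlinarith

lemma exists_le_max_of_sq_le_mul (N : ℕ) (K : ℝ≥0) :
    ∃ C : ℝ≥0, ∀ c : ℕ → ℝ≥0∞, (∀ j ≤ N, c j < ∞) →
      (∀ j, j + 2 ≤ N → c (j + 1) ^ 2 ≤ K * (c j * c (j + 2))) →
      ∀ j ≤ N, c j ≤ C * max (c 0) (c N) := by
  refine ⟨(K + 1) ^ N ^ 2, fun c hc h j hj => ?_⟩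
  set L : ℝ := K + 1 with hL
  have hL1 : 1 ≤ L := by simp [hL]
  have hKL : (K : ℝ) ≤ L ^ 2 := by nlinarith
  have hd0 : ∀ j ≤ N, 0 ≤ (c j).toReal * L ^ j ^ 2 := fun j _ => by positivity
  have hlog : ∀ j, j + 2 ≤ N → ((c (j + 1)).toReal * L ^ (j + 1) ^ 2) ^ 2 ≤
      (c j).toReal * L ^ j ^ 2 * ((c (j + 2)).toReal * L ^ (j + 2) ^ 2) := by
    intro j hj
    have h1 : (c (j + 1)).toReal ^ 2 ≤ K * ((c j).toReal * (c (j + 2)).toReal) := by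
      have := ENNReal.toReal_mono (ENNReal.mul_ne_top ENNReal.coe_ne_top
        (ENNReal.mul_ne_top (hc j (by lia)).ne (hc (j + 2) hj).ne)) (h j hj)
      simpa [ENNReal.toReal_pow, ENNReal.toReal_mul] using this
    calc ((c (j + 1)).toReal * L ^ (j + 1) ^ 2) ^ 2
        = (c (j + 1)).toReal ^ 2 * L ^ (2 * (j + 1) ^ 2) := by ring
      _ ≤ L ^ 2 * ((c j).toReal * (c (j + 2)).toReal) * L ^ (2 * (j + 1) ^ 2) := by
          gcongr
          exact h1.trans (by gcongr)
      _ = _ := by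
          have : L ^ j ^ 2 * L ^ (j + 2) ^ 2 = L ^ 2 * L ^ (2 * (j + 1) ^ 2) := by
            rw [← pow_add, ← pow_add]; congr 1; ring
          linear_combination (-(c j).toReal * (c (j + 2)).toReal) * this
  have hmax := le_max_endpoints_of_sq_le_mul hd0 hlog hj
  have hfin : max (c 0) (c N) ≠ ∞ := (max_lt (hc 0 (by lia)) (hc N le_rfl)).ne
  rw [← ENNReal.toReal_le_toReal (hc j hj).ne (ENNReal.mul_ne_top ENNReal.coe_ne_top hfin),
    ENNReal.toReal_mul, ENNReal.toReal_max (hc 0 (by lia)).ne (hc N le_rfl).ne,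
    ENNReal.coe_toReal]
  push_cast
  rw [← hL]
  calc (c j).toReal ≤ (c j).toReal * L ^ j ^ 2 :=
        le_mul_of_one_le_right ENNReal.toReal_nonneg (one_le_pow₀ hL1)
    _ ≤ _ := hmax
    _ ≤ L ^ N ^ 2 * max (c 0).toReal (c N).toReal := by
        refine max_le ?_ ?_
        · simp only [ne_eq, OfNat.ofNat_ne_zero, not_false_eq_true, zero_pow, pow_zero, mul_one]
          exact (le_max_left _ _).trans (le_mul_of_one_le_left
            (le_max_of_le_left ENNReal.toReal_nonneg) (one_le_pow₀ hL1))
        · rw [mul_comm]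
          gcongr
          exact le_max_right _ _

/-- The exponent whose inverse interpolates affinely between those of `r` and `s`. -/
def interpExponent (r s : ℝ≥0∞) (N j : ℕ) : ℝ≥0∞ :=
  (ENNReal.ofReal ((1 - j / N) * r⁻¹.toReal + j / N * s⁻¹.toReal))⁻¹

section interpExponent

variable {r s r' s' q : ℝ≥0∞} {N j : ℕ}

lemma interpExponent_zero (hr : 1 ≤ r) : interpExponent r s N 0 = r := by
  have : r⁻¹ ≠ ∞ := ENNReal.inv_ne_top.2 (zero_lt_one.trans_le hr).ne'
  simp only [interpExponent, Nat.cast_zero, zero_div, sub_zero, one_mul, zero_mul, add_zero]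
  rw [ENNReal.ofReal_toReal this, inv_inv]

lemma interpExponent_self (hs : 1 ≤ s) (hN : N ≠ 0) : interpExponent r s N N = s := by
  have : s⁻¹ ≠ ∞ := ENNReal.inv_ne_top.2 (zero_lt_one.trans_le hs).ne'
  have hN' : (N : ℝ) ≠ 0 := by exact_mod_cast hN
  simp only [interpExponent, div_self hN', sub_self, zero_mul, zero_add, one_mul]
  rw [ENNReal.ofReal_toReal this, inv_inv]

lemma div_mem_Icc_of_le (hj : j ≤ N) : (j : ℝ) / N ∈ Icc (0 : ℝ) 1 :=
  ⟨by positivity, div_le_one_of_le₀ (by exact_mod_cast hj) (by positivity)⟩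

lemma one_le_interpExponent (hr : 1 ≤ r) (hs : 1 ≤ s) (hj : j ≤ N) :
    1 ≤ interpExponent r s N j := by
  have h := div_mem_Icc_of_le hj
  have key : ∀ t : ℝ≥0∞, 1 ≤ t → t⁻¹.toReal ≤ 1 := fun t ht => by
    simpa using ENNReal.toReal_mono ENNReal.one_ne_top (ENNReal.inv_le_one.2 ht)
  rw [interpExponent, ENNReal.one_le_inv, ← ENNReal.ofReal_one]
  refine ENNReal.ofReal_le_ofReal ?_
  have := key r hr
  have := key s hs
  nlinarith [h.1, h.2]

lemma interpExponent_harmonic (hj : j + 2 ≤ N) :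
    (interpExponent r s N j)⁻¹ + (interpExponent r s N (j + 2))⁻¹ =
      2 * (interpExponent r s N (j + 1))⁻¹ := by
  have hnn : ∀ i ≤ N, 0 ≤ (1 - (i : ℝ) / N) * r⁻¹.toReal + i / N * s⁻¹.toReal := fun i hi => by
    have h := div_mem_Icc_of_le hi
    have := sub_nonneg.2 h.2
    positivity
  simp only [interpExponent, inv_inv]
  rw [← ENNReal.ofReal_add (hnn _ (by lia)) (hnn _ (by lia)),
    show (2 : ℝ≥0∞) = ENNReal.ofReal 2 by simp, ← ENNReal.ofReal_mul (by norm_num)]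
  congr 1
  push_cast
  ring

lemma interpExponent_holder (hr : 1 ≤ r) (hs : 1 ≤ s) (hr' : 1 ≤ r') (hs' : 1 ≤ s')
    (h : r⁻¹ + r'⁻¹ = q⁻¹) (h' : s⁻¹ + s'⁻¹ = q⁻¹) (hj : j ≤ N) :
    (interpExponent r s N j)⁻¹ + (interpExponent r' s' N j)⁻¹ = q⁻¹ := by
  have hj' := div_mem_Icc_of_le hj
  have h1 := sub_nonneg.2 hj'.2
  have h0 := hj'.1
  have hfin : ∀ t : ℝ≥0∞, 1 ≤ t → t⁻¹ ≠ ∞ := fun t ht =>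
    ENNReal.inv_ne_top.2 (zero_lt_one.trans_le ht).ne'
  have e1 := congrArg ENNReal.toReal h
  have e2 := congrArg ENNReal.toReal h'
  rw [ENNReal.toReal_add (hfin r hr) (hfin r' hr')] at e1
  rw [ENNReal.toReal_add (hfin s hs) (hfin s' hs')] at e2
  have hq : q⁻¹ ≠ ∞ := h ▸ ENNReal.add_ne_top.2 ⟨hfin r hr, hfin r' hr'⟩
  simp only [interpExponent, inv_inv]
  rw [← ENNReal.ofReal_add (by positivity) (by positivity), ← ENNReal.ofReal_toReal hq]
  congr 1
  linear_combination (1 - (j : ℝ) / N) * e1 + (j : ℝ) / N * e2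

end interpExponent

lemma exists_derivNorm_mul_le {n : ℕ} {Ω : Set (Fin n → ℝ)} (hΩ : SmoothDomain Ω) (N : ℕ) :
    ∃ C : ℝ≥0, ∀ (r1 r2 s1 s2 : ℝ≥0∞) (f g : (Fin n → ℝ) → ℝ), 1 ≤ r1 → 1 ≤ r2 → 1 ≤ s1 →
      1 ≤ s2 → ContDiff ℝ (N + 1 : ℕ) f → ContDiff ℝ (N + 1 : ℕ) g → ∀ j ≤ N,
      derivNorm 1 (j + 1) (interpExponent r1 s2 N j) Ω f *
          derivNorm 0 (N - j) (interpExponent s1 r2 N j) Ω g ≤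
        C * (derivNorm 1 1 r1 Ω f * derivNorm 0 N s1 Ω g +
          derivNorm 0 0 r2 Ω g * derivNorm 0 (N + 1) s2 Ω f) := by
  obtain ⟨K, hK⟩ := exists_derivNorm_sq_le hΩ N
  obtain ⟨C, hC⟩ := exists_le_max_of_sq_le_mul N (K * K)
  refine ⟨C, fun r1 r2 s1 s2 f g hr1 hr2 hs1 hs2 hf hg j hj => ?_⟩
  refine (hC (fun j => derivNorm 1 (j + 1) (interpExponent r1 s2 N j) Ω f *
    derivNorm 0 (N - j) (interpExponent s1 r2 N j) Ω g) ?_ ?_ j hj).trans ?_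
  · intro j hj
    exact ENNReal.mul_lt_top
      (derivNorm_lt_top hΩ _ _ _ (hf.of_le (by exact_mod_cast by lia)))
      (derivNorm_lt_top hΩ _ _ _ (hg.of_le (by exact_mod_cast by lia)))
  · intro j hj
    obtain ⟨b, hb⟩ : ∃ b, N = b + (j + 2) := ⟨N - (j + 2), by lia⟩
    have h1 := hK 1 (j + 1) f (interpExponent r1 s2 N (j + 1)) (interpExponent r1 s2 N j)
      (interpExponent r1 s2 N (j + 2)) (by lia) (by lia)
      (hf.of_le (by exact_mod_cast by lia)) (one_le_interpExponent hr1 hs2 (by lia))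
      (one_le_interpExponent hr1 hs2 (by lia)) (one_le_interpExponent hr1 hs2 (by lia))
      (interpExponent_harmonic hj)
    have h2 := hK 0 b g (interpExponent s1 r2 N (j + 1)) (interpExponent s1 r2 N (j + 2))
      (interpExponent s1 r2 N j) (by lia) (by lia)
      (hg.of_le (by exact_mod_cast by lia)) (one_le_interpExponent hs1 hr2 (by lia))
      (one_le_interpExponent hs1 hr2 (by lia)) (one_le_interpExponent hs1 hr2 (by lia))
      ((add_comm _ _).trans (interpExponent_harmonic hj))
    simp only [show N - (j + 1) = b + 1 by lia, show N - j = b + 2 by lia,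
      show N - (j + 2) = b by lia]
    rw [mul_pow]
    refine (mul_le_mul' h1 h2).trans (le_of_eq ?_)
    push_cast
    ring
  · gcongr
    refine max_le ?_ ?_
    · simp only [interpExponent_zero hr1, interpExponent_zero hs1]
      exact le_self_add
    · rcases eq_or_ne N 0 with rfl | hN
      · simp only [interpExponent_zero hr1, interpExponent_zero hs1]
        exact le_self_add
      · simp only [interpExponent_self hs2 hN, interpExponent_self hr2 hN, Nat.sub_self]
        refine le_add_of_nonneg_of_le zero_le ?_
        rw [mul_comm]
        gcongr
        exact Finset.sum_le_sum_of_subset (Finset.Icc_subset_Icc_left (by lia))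

lemma exists_Dlist_eq_iteratedFDeriv {n : ℕ} (l : List (Fin n)) :
    ∃ v : Fin l.length → Fin n → ℝ, (∀ k, ‖v k‖ ≤ 1) ∧ ∀ φ : (Fin n → ℝ) → ℝ,
      ContDiff ℝ l.length φ → ∀ x, Dlist l φ x = iteratedFDeriv ℝ l.length φ x v := by
  induction l with
  | nil => exact ⟨fun _ => 0, fun k => k.elim0, fun φ _ x => by simp [Dlist]⟩
  | cons i l ih =>
    obtain ⟨v, hv, h⟩ := ih
    refine ⟨Fin.cons (Pi.single i 1) v, fun k => ?_, fun φ hφ x => ?_⟩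
    · refine Fin.cases ?_ (fun k => ?_) k
      · rw [Fin.cons_zero, Pi.norm_single]; simp
      · rw [Fin.cons_succ]; exact hv k
    · have hφ' : ContDiff ℝ (l.length + 1 : ℕ) φ := hφ
      have hd : DifferentiableAt ℝ (iteratedFDeriv ℝ l.length φ) x :=
        hφ'.differentiable_iteratedFDeriv (by exact_mod_cast Nat.lt_succ_self _) x
      have hfun : Dlist l φ = fun y => iteratedFDeriv ℝ l.length φ y v :=
        funext (h φ (hφ'.of_le (by exact_mod_cast Nat.le_succ _)))
      change fderiv ℝ (Dlist l φ) x (Pi.single i 1) =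
        iteratedFDeriv ℝ (l.length + 1) φ x (Fin.cons (Pi.single i 1) v)
      rw [hd.iteratedFDeriv_succ_apply_left', hfun]
      simp

lemma length_flatMap_replicate {n : ℕ} (α : Fin n → ℕ) :
    ((List.finRange n).flatMap fun i => List.replicate (α i) i).length = mOrder α := by
  simp [List.length_flatMap, mOrder, Fin.sum_univ_def]

lemma exists_Dm_eq_iteratedFDeriv {n m : ℕ} {α : Fin n → ℕ} (hα : mOrder α = m) :
    ∃ v : Fin m → Fin n → ℝ, (∀ k, ‖v k‖ ≤ 1) ∧ ∀ φ : (Fin n → ℝ) → ℝ,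
      ContDiff ℝ m φ → ∀ x, Dm α φ x = iteratedFDeriv ℝ m φ x v := by
  have hl := (length_flatMap_replicate α).trans hα
  subst hl
  exact exists_Dlist_eq_iteratedFDeriv _

/-- Pointwise form of the commutator estimate, from the Leibniz rule applied to `(f - f x) * g`. -/
lemma norm_commutator_le {n N : ℕ} {α : Fin n → ℕ} (hα : mOrder α = N + 1)
    {f g : (Fin n → ℝ) → ℝ} (hf : ContDiff ℝ (N + 1 : ℕ) f) (hg : ContDiff ℝ (N + 1 : ℕ) g)
    (x : Fin n → ℝ) :
    ‖Dm α (fun y => f y * g y) x - f x * Dm α g x‖ ≤ ∑ j ∈ Finset.range (N + 1),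
      ((N + 1).choose (j + 1) : ℝ) *
        (‖iteratedFDeriv ℝ (j + 1) f x‖ * ‖iteratedFDeriv ℝ (N - j) g x‖) := by
  obtain ⟨v, hv, h⟩ := exists_Dm_eq_iteratedFDeriv hα
  set c := f x with hc
  have hfc : ContDiff ℝ (N + 1 : ℕ) fun y => f y - c := hf.sub contDiff_const
  have hcg : ContDiff ℝ (N + 1 : ℕ) (c • g) := contDiff_const.smul hg
  have hprod : (fun y => (f y - c) * g y) = (fun y => f y * g y) - c • g := by
    ext y; simp only [Pi.sub_apply, Pi.smul_apply, smul_eq_mul]; ring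
  have heq : Dm α (fun y => f y * g y) x - c * Dm α g x =
      iteratedFDeriv ℝ (N + 1) (fun y => (f y - c) * g y) x v := by
    rw [h _ (hf.mul hg), h _ hg, hprod, iteratedFDeriv_sub_apply (hf.mul hg).contDiffAt
      hcg.contDiffAt, iteratedFDeriv_const_smul_apply hg.contDiffAt]
    simp
  have hzero : ‖iteratedFDeriv ℝ 0 (fun y => f y - c) x‖ = 0 := by
    rw [norm_iteratedFDeriv_zero, hc, sub_self, norm_zero]
  have hsucc : ∀ j ≤ N, iteratedFDeriv ℝ (j + 1) (fun y => f y - c) x =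
      iteratedFDeriv ℝ (j + 1) f x := fun j hj => by
    rw [fun_iteratedFDeriv_sub_apply (hf.of_le (by exact_mod_cast by lia)).contDiffAt
      contDiff_const.contDiffAt, iteratedFDeriv_succ_const]
    simp
  have hone : ∏ k, ‖v k‖ ≤ 1 := Finset.prod_le_one (fun _ _ => norm_nonneg _) fun k _ => hv k
  calc _ = ‖iteratedFDeriv ℝ (N + 1) (fun y => (f y - c) * g y) x v‖ := by rw [heq]
    _ ≤ ‖iteratedFDeriv ℝ (N + 1) (fun y => (f y - c) * g y) x‖ * ∏ k, ‖v k‖ :=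
        ContinuousMultilinearMap.le_opNorm _ _
    _ ≤ ‖iteratedFDeriv ℝ (N + 1) (fun y => (f y - c) * g y) x‖ :=
        mul_le_of_le_one_right (norm_nonneg _) hone
    _ ≤ _ := norm_iteratedFDeriv_mul_le hfc hg x le_rfl
    _ = _ := by
        rw [Finset.sum_range_succ', hzero, mul_zero, zero_mul, add_zero]
        refine Finset.sum_congr rfl fun j hj => ?_
        rw [hsucc j (Nat.lt_succ_iff.1 (Finset.mem_range.1 hj)), Nat.add_sub_add_right, mul_assoc]

lemma WNorm_eq_derivNorm {n : ℕ} (m : ℕ) (q : ℝ≥0∞) (Ω : Set (Fin n → ℝ))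
    (f : (Fin n → ℝ) → ℝ) : WNorm m q Ω f = derivNorm 0 m q Ω f := by
  rw [WNorm, derivNorm, Nat.range_succ_eq_Icc_zero]

lemma LqN_eq_derivNorm {n : ℕ} (q : ℝ≥0∞) (Ω : Set (Fin n → ℝ))
    (f : (Fin n → ℝ) → ℝ) : LqN q Ω f = derivNorm 0 0 q Ω f := by
  simp only [LqN, derivNorm, Finset.Icc_self, Finset.sum_singleton, norm_iteratedFDeriv_zero]
  exact (eLpNorm_norm f).symm

lemma eLpNorm_fderiv_eq_derivNorm {n : ℕ} (q : ℝ≥0∞) (Ω : Set (Fin n → ℝ))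
    (f : (Fin n → ℝ) → ℝ) :
    eLpNorm (fun x => ‖fderiv ℝ f x‖) q (volume.restrict Ω) = derivNorm 1 1 q Ω f := by
  simp only [derivNorm, Finset.Icc_self, Finset.sum_singleton, norm_iteratedFDeriv_one]

/-- **Commutator estimate in Sobolev spaces on a bounded smooth domain**
(inequality (2.2) of the paper): for `|α| = m` and exponents satisfying
`1/q = 1/r₁ + 1/s₁ = 1/r₂ + 1/s₂`,
`‖[D^α, f]g‖_{L^q} ≤ C(‖∇f‖_{L^{r₁}}‖g‖_{W^{m−1,s₁}} + ‖g‖_{L^{r₂}}‖f‖_{W^{m,s₂}})`,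
where `[D^α, f]g = D^α(fg) − f D^α g`. -/
theorem sobolev_commutator_estimate
    (n m : ℕ) (hn : 2 ≤ n) (hm : 1 ≤ m)
    (Ω : Set (Fin n → ℝ)) (hΩ : SmoothDomain Ω)
    (q r1 r2 s1 s2 : ℝ≥0∞)
    (hq : 1 ≤ q) (hr1 : 1 ≤ r1) (hr2 : 1 ≤ r2) (hs1 : 1 ≤ s1) (hs2 : 1 ≤ s2)
    (hqs1 : 1 / q = 1 / r1 + 1 / s1) (hqs2 : 1 / q = 1 / r2 + 1 / s2) :
    ∃ C : ℝ≥0, 0 < C ∧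
      ∀ (α : Fin n → ℕ), mOrder α = m →
        ∀ f g : (Fin n → ℝ) → ℝ, ContDiff ℝ m f → ContDiff ℝ m g →
          LqN q Ω (fun x => Dm α (fun y => f y * g y) x - f x * Dm α g x)
            ≤ (C : ℝ≥0∞) *
                (eLpNorm (fun x => ‖fderiv ℝ f x‖) r1 (volume.restrict Ω)
                    * WNorm (m - 1) s1 Ω g
                  + LqN r2 Ω g * WNorm m s2 Ω f) := by
  obtain ⟨N, rfl⟩ : ∃ N, m = N + 1 := ⟨m - 1, by lia⟩
  obtain ⟨C, hC⟩ := exists_derivNorm_mul_le hΩ N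
  refine ⟨1 + ∑ j ∈ Finset.range (N + 1), ((N + 1).choose (j + 1) : ℝ≥0) * C,
    add_pos_of_pos_of_nonneg one_pos zero_le, fun α hα f g hf hg => ?_⟩
  rw [eLpNorm_fderiv_eq_derivNorm, WNorm_eq_derivNorm, WNorm_eq_derivNorm,
    LqN_eq_derivNorm r2, Nat.add_sub_cancel]
  set R := derivNorm 1 1 r1 Ω f * derivNorm 0 N s1 Ω g +
    derivNorm 0 0 r2 Ω g * derivNorm 0 (N + 1) s2 Ω f with hR
  have hfc : ∀ j ≤ N + 1, Continuous fun x => ‖iteratedFDeriv ℝ j f x‖ := fun j hj =>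
    (hf.continuous_iteratedFDeriv (by exact_mod_cast hj)).norm
  have hgc : ∀ j ≤ N + 1, Continuous fun x => ‖iteratedFDeriv ℝ j g x‖ := fun j hj =>
    (hg.continuous_iteratedFDeriv (by exact_mod_cast hj)).norm
  simp only [one_div] at hqs1 hqs2
  calc LqN q Ω (fun x => Dm α (fun y => f y * g y) x - f x * Dm α g x)
      ≤ eLpNorm (∑ j ∈ Finset.range (N + 1), ((N + 1).choose (j + 1) : ℝ) •
          ((fun x => ‖iteratedFDeriv ℝ (j + 1) f x‖) • fun x => ‖iteratedFDeriv ℝ (N - j) g x‖))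
          q (volume.restrict Ω) :=
        eLpNorm_mono_real fun x => by
          simpa [Finset.sum_apply] using norm_commutator_le hα hf hg x
    _ ≤ ∑ j ∈ Finset.range (N + 1), ((N + 1).choose (j + 1) : ℝ≥0∞) * (C * R) := by
        refine (eLpNorm_sum_le (fun j hj => ?_) hq).trans (Finset.sum_le_sum fun j hj => ?_)
        · have hj := Finset.mem_range.1 hj
          exact (((hfc (j + 1) (by lia)).smul (hgc (N - j) (by lia))).const_smul
            _).aestronglyMeasurable
        · have hj : j ≤ N := Nat.lt_succ_iff.1 (Finset.mem_range.1 hj)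
          have htr : HolderTriple (interpExponent r1 s2 N j) (interpExponent s1 r2 N j) q :=
            ⟨interpExponent_holder hr1 hs2 hs1 hr2 hqs1.symm
              ((add_comm _ _).trans hqs2.symm) hj⟩
          rw [eLpNorm_const_smul, enorm_natCast]
          gcongr
          refine (eLpNorm_smul_le_mul_eLpNorm (p := interpExponent r1 s2 N j)
            (q := interpExponent s1 r2 N j) (hgc (N - j) (by lia)).aestronglyMeasurable
            (hfc (j + 1) (by lia)).aestronglyMeasurable).trans
            (le_trans ?_ (hC r1 r2 s1 s2 f g hr1 hr2 hs1 hs2 hf hg j hj))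
          exact mul_le_mul' (eLpNorm_iteratedFDeriv_le_derivNorm (by lia) le_rfl _ _ _)
            (eLpNorm_iteratedFDeriv_le_derivNorm (by lia) le_rfl _ _ _)
    _ ≤ _ := by
        push_cast
        simp_rw [← mul_assoc]
        rw [← Finset.sum_mul]
        gcongr
        exact le_add_self

end
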